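/- arXiv:2403.04718 — 5 statements merged into one kernel-verified Lean document; each statement's English description precedes it below -/
import Mathlib

section
/- (Theorem 3.7, part II: orbital local controllability over one period.) Let U ⊆ ℝ^m be convex, compact, with 0 ∈ U and span U = ℝ^m, and assume every trajectory of X⁰ is periodic and X⁰ has no equilibrium. Fix x ∈ ℝ^d. If {c + λ·X⁰(x) : c ∈ cone E^U(x), λ ∈ ℝ} = ℝ^d, then for every ε > 0 the flow-saturation of the accessible set over one period, namely the set {y ∈ ℝ^d : ∃ s ∈ ℝ with φ⁰(s,y) ∈ A^{εU}_{T(x)}(x)}, is a neighborhood of x in ℝ^d (this expresses that the projection of A^{εU}_{T(x)}(x) to the space of periodic orbits of X⁰ is a neighborhood of the orbit of x). Here εU = {εu : u ∈ U}. -/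
open Set MeasureTheory
open scoped Pointwise

noncomputable section

/-- `ℝ^d` as a Euclidean space. -/
abbrev Ed (d : ℕ) := EuclideanSpace ℝ (Fin d)

/-- Conic hull of a set: all finite conic combinations of elements of `S`. -/
def coneHull {V : Type*} [AddCommMonoid V] [Module ℝ V] (S : Set V) : Set V :=
  {y | ∃ (j : ℕ) (v : Fin j → V) (c : Fin j → ℝ),
    (∀ i, v i ∈ S) ∧ (∀ i, 0 ≤ c i) ∧ y = ∑ i, c i • v i}

/-- `(x, u)` is a solution of the affine control system
`ẋ = X⁰(x) + ∑ u_k X^k(x)` on `[0, tf]` with control constrained to `U`: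
`u` is measurable, `U`-valued and essentially bounded on `[0,tf]`, and `x` is
absolutely continuous, given as the integral of the right-hand side. -/
def IsSol {d m : ℕ} (X0 : Ed d → Ed d) (X : Fin m → Ed d → Ed d)
    (U : Set (Fin m → ℝ)) (tf : ℝ) (x : ℝ → Ed d) (u : ℝ → Fin m → ℝ) : Prop :=
  Measurable u ∧ (∀ t ∈ Icc (0:ℝ) tf, u t ∈ U) ∧
    (∃ C, ∀ t ∈ Icc (0:ℝ) tf, ‖u t‖ ≤ C) ∧
    IntervalIntegrable (fun s => X0 (x s) + ∑ k, u s k • X k (x s)) volume 0 tf ∧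
    ∀ t ∈ Icc (0:ℝ) tf, x t = x 0 + ∫ s in (0:ℝ)..t, (X0 (x s) + ∑ k, u s k • X k (x s))

/-- The accessible set `A^U_{tf}(x₀)`. -/
def Access {d m : ℕ} (X0 : Ed d → Ed d) (X : Fin m → Ed d → Ed d)
    (U : Set (Fin m → ℝ)) (tf : ℝ) (x0 : Ed d) : Set (Ed d) :=
  {y | ∃ x u, IsSol X0 X U tf x u ∧ x 0 = x0 ∧ x tf = y}

/-- Pushforward `(exp(−τX⁰)_* Z)(x)` of the vector field `Z` along the flow `φ` of `X⁰`. -/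
def pushf {d : ℕ} (φ : ℝ → Ed d → Ed d) (Z : Ed d → Ed d) (τ : ℝ) (x : Ed d) : Ed d :=
  fderiv ℝ (φ (-τ)) (φ τ x) (Z (φ τ x))

/-- The set `E^U_τ(x)`. -/
def EsetAt {d m : ℕ} (φ : ℝ → Ed d → Ed d) (X : Fin m → Ed d → Ed d)
    (U : Set (Fin m → ℝ)) (τ : ℝ) (x : Ed d) : Set (Ed d) :=
  {v | ∃ u ∈ U, v = ∑ k, u k • pushf φ (X k) τ x}

/-- The set `E^U_{[t₁,t₂]}(x)`. -/
def EIcc {d m : ℕ} (φ : ℝ → Ed d → Ed d) (X : Fin m → Ed d → Ed d)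
    (U : Set (Fin m → ℝ)) (t₁ t₂ : ℝ) (x : Ed d) : Set (Ed d) :=
  ⋃ τ ∈ Icc t₁ t₂, EsetAt φ X U τ x

open Filter Topology Metric NNReal

/-- A solution provided by the Picard–Lindelöf theorem that stays in the ball on which the
vector field is controlled. -/
theorem IsPicardLindelof.exists_solution_mem_closedBall {E : Type*} [NormedAddCommGroup E]
    [NormedSpace ℝ E] [CompleteSpace E] {f : ℝ → E → E} {tmin tmax : ℝ} {t₀ : Icc tmin tmax}
    {x₀ : E} {a L K : ℝ≥0} (hf : IsPicardLindelof f t₀ x₀ a 0 L K) :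
    ∃ α : ℝ → E, α t₀ = x₀ ∧ (∀ t, α t ∈ closedBall x₀ a) ∧
      ∀ t ∈ Icc tmin tmax, HasDerivWithinAt α (f t (α t)) (Icc tmin tmax) t := by
  obtain ⟨α, hα⟩ := ODE.FunSpace.exists_isFixedPt_next hf (mem_closedBall_self le_rfl)
  refine ⟨α.compProj,
    by rw [ODE.FunSpace.compProj_val, ← hα, ODE.FunSpace.next_apply₀],
    fun t ↦ α.compProj_mem_closedBall hf.mul_max_le, fun t ht ↦ ?_⟩
  apply ODE.hasDerivWithinAt_picard_Icc t₀.2 hf.continuousOn_uncurry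
    α.continuous_compProj.continuousOn (fun _ _ ↦ α.compProj_mem_closedBall hf.mul_max_le)
    x₀ ht |>.congr_of_mem _ ht
  intro t' ht'
  nth_rw 1 [← hα]
  rw [ODE.FunSpace.compProj_of_mem ht', ODE.FunSpace.next_apply]

section LinearParameter

variable {P E : Type*} [NormedAddCommGroup P] [NormedSpace ℝ P] [NormedAddCommGroup E]
  [NormedSpace ℝ E] {A : ℝ → E → P →L[ℝ] E} {x : E} {a M K : ℝ≥0} {T : ℝ}

/-- Solutions of `ż = A(t, z) p` with the same initial value depend on the parameter `p` in a
Lipschitz way, for small parameters. -/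
lemma dist_solution_le (hT : 0 ≤ T)
    (hlip : ∀ t ∈ Icc 0 T, LipschitzOnWith K (A t) (closedBall x a))
    (hM : ∀ t ∈ Icc 0 T, ∀ z ∈ closedBall x a, ‖A t z‖ ≤ M) {p q : P} {y z : ℝ → E}
    (hy0 : y 0 = x) (hz0 : z 0 = x) (hya : ∀ t, y t ∈ closedBall x a)
    (hza : ∀ t, z t ∈ closedBall x a)
    (hy : ∀ t ∈ Icc 0 T, HasDerivWithinAt y (A t (y t) p) (Icc 0 T) t)
    (hz : ∀ t ∈ Icc 0 T, HasDerivWithinAt z (A t (z t) q) (Icc 0 T) t)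
    (hq : K * T * ‖q‖ ≤ 1 / 2) :
    ∀ t ∈ Icc 0 T, ‖y t - z t‖ ≤ 2 * T * M * ‖p - q‖ := by
  have hcont : ContinuousOn (fun t ↦ ‖y t - z t‖) (Icc 0 T) :=
    ((HasDerivWithinAt.continuousOn hy).sub (HasDerivWithinAt.continuousOn hz)).norm
  obtain ⟨τ, hτ, hmax⟩ := isCompact_Icc.exists_isMaxOn ⟨0, left_mem_Icc.2 hT⟩ hcont
  have hderiv : ∀ t ∈ Ico 0 T, ‖A t (y t) p - A t (z t) q‖ ≤
      M * ‖p - q‖ + K * ‖y τ - z τ‖ * ‖q‖ := by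
    intro t ht
    have ht' := Ico_subset_Icc_self ht
    have e : A t (y t) p - A t (z t) q = A t (y t) (p - q) + (A t (y t) - A t (z t)) q := by
      simp
    rw [e]
    refine (norm_add_le _ _).trans (add_le_add ?_ ?_)
    · exact (A t (y t)).le_of_opNorm_le (hM t ht' _ (hya t)) _
    · refine (A t (y t) - A t (z t)).le_of_opNorm_le ?_ _
      refine ((hlip t ht').norm_sub_le (hya t) (hza t)).trans ?_
      gcongr
      exact hmax ht'
  have hle := norm_image_sub_le_of_norm_deriv_le_segment'
    (fun t ht ↦ (hy t ht).sub (hz t ht)) hderiv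
  simp only [Pi.sub_apply, hy0, hz0, sub_self, sub_zero] at hle
  have hτ' := hle τ hτ
  intro t ht
  refine (hmax ht).trans ?_
  have h1 : (M * ‖p - q‖ + K * ‖y τ - z τ‖ * ‖q‖) * τ ≤
      (M * ‖p - q‖ + K * ‖y τ - z τ‖ * ‖q‖) * T := by
    gcongr
    exact hτ.2
  have h2 : K * T * ‖q‖ * ‖y τ - z τ‖ ≤ 1 / 2 * ‖y τ - z τ‖ := by gcongr
  simp only
  nlinarith

/-- Solutions of `ż = A(t, z) p` stay close to their initial value when `p` is small. -/
lemma norm_solution_sub_le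
    (hM : ∀ t ∈ Icc 0 T, ∀ z ∈ closedBall x a, ‖A t z‖ ≤ M) {p : P} {y : ℝ → E}
    (hy0 : y 0 = x) (hya : ∀ t, y t ∈ closedBall x a)
    (hy : ∀ t ∈ Icc 0 T, HasDerivWithinAt y (A t (y t) p) (Icc 0 T) t) :
    ∀ t ∈ Icc 0 T, ‖y t - x‖ ≤ M * ‖p‖ * T := by
  intro t ht
  have h := norm_image_sub_le_of_norm_deriv_le_segment' hy (C := M * ‖p‖) (fun t ht ↦
    (A t (y t)).le_of_opNorm_le (hM t (Ico_subset_Icc_self ht) _ (hya t)) _) t ht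
  rw [hy0, sub_zero] at h
  refine h.trans ?_
  gcongr
  exact ht.2

/-- First order expansion, with respect to the parameter, of the solutions of `ż = A(t, z) p`. -/
lemma norm_solution_sub_sub_integral_le [CompleteSpace E] (hT : 0 ≤ T)
    (hA : Continuous (A · x))
    (hlip : ∀ t ∈ Icc 0 T, LipschitzOnWith K (A t) (closedBall x a))
    (hM : ∀ t ∈ Icc 0 T, ∀ z ∈ closedBall x a, ‖A t z‖ ≤ M) {p q : P} {y z : ℝ → E}
    (hy0 : y 0 = x) (hz0 : z 0 = x) (hya : ∀ t, y t ∈ closedBall x a)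
    (hza : ∀ t, z t ∈ closedBall x a)
    (hy : ∀ t ∈ Icc 0 T, HasDerivWithinAt y (A t (y t) p) (Icc 0 T) t)
    (hz : ∀ t ∈ Icc 0 T, HasDerivWithinAt z (A t (z t) q) (Icc 0 T) t)
    (hq : K * T * ‖q‖ ≤ 1 / 2) :
    ‖y T - z T - (∫ t in (0 : ℝ)..T, A t x) (p - q)‖ ≤
      K * M * T ^ 2 * (‖p‖ + 2 * ‖q‖) * ‖p - q‖ := by
  have hx : x ∈ closedBall x a := mem_closedBall_self a.2
  have hD := dist_solution_le hT hlip hM hy0 hz0 hya hza hy hz hq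
  have hp := norm_solution_sub_le hM hy0 hya hy
  have hI : ∀ t ∈ Icc 0 T, HasDerivWithinAt
      (fun t ↦ y t - z t - (∫ s in (0 : ℝ)..t, A s x) (p - q))
      (A t (y t) p - A t (z t) q - A t x (p - q)) (Icc 0 T) t := fun t ht ↦
    ((hy t ht).sub (hz t ht)).sub
      (((hA.integral_hasStrictDerivAt 0 t).hasDerivAt.clm_apply
        (hasDerivAt_const t (p - q))).hasDerivWithinAt.congr_deriv (by simp))
  have hbound : ∀ t ∈ Ico 0 T, ‖A t (y t) p - A t (z t) q - A t x (p - q)‖ ≤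
      K * M * T * (‖p‖ + 2 * ‖q‖) * ‖p - q‖ := by
    intro t ht
    have ht' := Ico_subset_Icc_self ht
    have e : A t (y t) p - A t (z t) q - A t x (p - q) =
        (A t (y t) - A t x) (p - q) + (A t (y t) - A t (z t)) q := by
      simp only [map_sub, sub_apply]
      abel
    rw [e]
    calc _ ≤ ‖(A t (y t) - A t x) (p - q)‖ + ‖(A t (y t) - A t (z t)) q‖ := norm_add_le _ _
      _ ≤ K * (M * ‖p‖ * T) * ‖p - q‖ + K * (2 * T * M * ‖p - q‖) * ‖q‖ := by
        refine add_le_add ((A t (y t) - A t x).le_of_opNorm_le ?_ _)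
          ((A t (y t) - A t (z t)).le_of_opNorm_le ?_ _)
        · refine ((hlip t ht').norm_sub_le (hya t) hx).trans ?_
          gcongr
          exact hp t ht'
        · refine ((hlip t ht').norm_sub_le (hya t) (hza t)).trans ?_
          gcongr
          exact hD t ht'
      _ = _ := by ring
  have := norm_image_sub_le_of_norm_deriv_le_segment' hI hbound T (right_mem_Icc.2 hT)
  simp only [hy0, hz0, intervalIntegral.integral_same, sub_self, sub_zero,
    zero_apply] at this
  exact this.trans_eq (by ring)

/-- The endpoint of the solution of `ż = A(t, z) p`, `z(0) = x` exists for small `p` and is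
strictly differentiable with respect to `p` at `0`. -/
theorem exists_solution_hasStrictFDerivAt [CompleteSpace E] (hT : 0 ≤ T) (ha : 0 < a)
    (hA : ∀ z, Continuous (A · z))
    (hlip : ∀ t ∈ Icc 0 T, LipschitzOnWith K (A t) (closedBall x a))
    (hM : ∀ t ∈ Icc 0 T, ∀ z ∈ closedBall x a, ‖A t z‖ ≤ M) :
    ∃ z : P → ℝ → E, z 0 T = x ∧ (∀ᶠ p in 𝓝 (0 : P), z p 0 = x ∧
      ∀ t ∈ Icc 0 T, HasDerivWithinAt (z p) (A t (z p t) p) (Icc 0 T) t) ∧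
      HasStrictFDerivAt (fun p ↦ z p T) (∫ t in (0 : ℝ)..T, A t x) 0 := by
  have hex : ∀ p : P, M * T * ‖p‖ ≤ a → ∃ z : ℝ → E, z 0 = x ∧ (∀ t, z t ∈ closedBall x a) ∧
      ∀ t ∈ Icc 0 T, HasDerivWithinAt z (A t (z t) p) (Icc 0 T) t := by
    intro p hp
    refine IsPicardLindelof.exists_solution_mem_closedBall (t₀ := ⟨0, left_mem_Icc.2 hT⟩)
      (f := fun t z ↦ A t z p) (L := M * ‖p‖₊) (K := K * ‖p‖₊) ⟨fun t ht ↦ ?_, fun z _ ↦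
        ((hA z).clm_apply continuous_const).continuousOn, fun t ht z hz ↦ ?_, ?_⟩
    · refine LipschitzOnWith.of_dist_le_mul fun z hz w hw ↦ ?_
      rw [dist_eq_norm, dist_eq_norm, ← sub_apply]
      refine ((A t z - A t w).le_of_opNorm_le ((hlip t ht).norm_sub_le hz hw) _).trans_eq ?_
      push_cast
      ring
    · exact (A t z).le_of_opNorm_le (hM t ht z hz) _
    · simp only [NNReal.coe_mul, coe_nnnorm, sub_zero, NNReal.coe_zero]
      rw [max_eq_left (by simpa using hT)]
      linarith
  choose! z hz0 hza hz using hex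
  have hsmall : ∀ c b : ℝ, 0 < b → ∀ᶠ p in 𝓝 (0 : P), c * ‖p‖ ≤ b := by
    intro c b hb
    have : Tendsto (fun p : P ↦ c * ‖p‖) (𝓝 0) (𝓝 0) := by
      have h : Continuous fun p : P ↦ c * ‖p‖ := by fun_prop
      simpa using h.tendsto 0
    exact (this.eventually_lt_const hb).mono fun _ h ↦ h.le
  have hex := hsmall (M * T) a ha
  refine ⟨z, ?_, hex.mono fun p hp ↦ ⟨hz0 p hp, hz p hp⟩, .of_isLittleO ?_⟩
  · have h0 := hex.self_of_nhds
    have := norm_solution_sub_le hM (hz0 _ h0) (hza _ h0) (hz _ h0) T (right_mem_Icc.2 hT)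
    simpa [sub_eq_zero] using this
  · rw [Asymptotics.isLittleO_iff]
    intro c hc
    have hlim := (hex.and ((hsmall (K * T) (1 / 2) (by norm_num)).and
      (hsmall (K * M * T ^ 2) (c / 3) (by positivity))))
    rw [nhds_prod_eq]
    filter_upwards [hlim.prod_mk hlim] with ⟨p, q⟩ ⟨⟨hp, _, hp'⟩, ⟨hq, hqK, hq'⟩⟩
    refine (norm_solution_sub_sub_integral_le hT (hA x) hlip hM (hz0 p hp) (hz0 q hq) (hza p hp)
      (hza q hq) (hz p hp) (hz q hq) hqK).trans ?_
    gcongr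
    simp only at hp' hq'
    linarith

end LinearParameter

/-- If `F : ℝ × E → E` has the second projection as strict derivative at `0`, then, for small
`r > 0`, the set `{(r, y) | ‖y‖ ≤ r}` is sent by `F` onto a neighborhood of `F 0`. -/
lemma eventually_image_mem_nhds_of_hasStrictFDerivAt_snd {E : Type*} [NormedAddCommGroup E]
    [NormedSpace ℝ E] [CompleteSpace E] {F : ℝ × E → E}
    (hF : HasStrictFDerivAt F (ContinuousLinearMap.snd ℝ ℝ E) 0) :
    ∀ᶠ r in 𝓝[>] (0 : ℝ), (fun y ↦ F (r, y)) '' closedBall 0 r ∈ 𝓝 (F 0) := by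
  obtain ⟨s, hs, hFs⟩ := hF.approximates_deriv_on_nhds (c := 1 / 4) (.inr (by norm_num))
  obtain ⟨δ, hδ, hball⟩ := Metric.mem_nhds_iff.1 hs
  filter_upwards [Ioo_mem_nhdsGT hδ] with r ⟨hr, hrδ⟩
  have hmem : ∀ y ∈ closedBall (0 : E) r, ((r, y) : ℝ × E) ∈ s := fun y hy ↦ hball <| by
    rw [mem_ball_zero_iff, Prod.norm_mk, max_lt_iff, Real.norm_of_nonneg hr.le]
    exact ⟨hrδ, (mem_closedBall_zero_iff.1 hy).trans_lt hrδ⟩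
  have happ : ApproximatesLinearOn (fun y ↦ F (r, y)) (ContinuousLinearMap.id ℝ E)
      (closedBall 0 r) (1 / 4) := fun y hy y' hy' ↦ by
    simpa [Prod.norm_mk] using hFs _ (hmem y hy) _ (hmem y' hy')
  have hsurj := happ.surjOn_closedBall_of_nonlinearRightInverse
    ⟨id, 1, fun y ↦ by simp, fun y ↦ rfl⟩ hr.le subset_rfl
  have hdist : ‖F 0 - F (r, 0)‖ ≤ 1 / 4 * r := by
    simpa [Prod.norm_mk, _root_.abs_of_pos hr, max_eq_left hr.le] using
      hFs 0 (mem_of_mem_nhds hs) (r, 0) (hmem 0 (mem_closedBall_self hr.le))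
  refine mem_of_superset (closedBall_mem_nhds_of_mem ?_) hsurj
  rw [mem_ball, dist_eq_norm]
  refine hdist.trans_lt ?_
  push_cast
  norm_num
  linarith

/-- In finite dimension, a convex cone on which no nonzero linear functional is nonpositive is the
whole space. -/
lemma eq_univ_of_forall_dual_nonpos_eq_zero {E : Type*} [NormedAddCommGroup E] [NormedSpace ℝ E]
    [FiniteDimensional ℝ E] {C : Set E} (h0 : 0 ∈ C) (hadd : ∀ y ∈ C, ∀ z ∈ C, y + z ∈ C)
    (hsmul : ∀ c : ℝ, 0 ≤ c → ∀ y ∈ C, c • y ∈ C)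
    (hdual : ∀ f : StrongDual ℝ E, (∀ y ∈ C, f y ≤ 0) → f = 0) : C = univ := by
  have hconv : Convex ℝ C := fun y hy z hz a b ha hb _ ↦
    hadd _ (hsmul a ha y hy) _ (hsmul b hb z hz)
  have hspan : Submodule.span ℝ C = ⊤ := by
    by_contra hne
    obtain ⟨f, hf, hle⟩ := Submodule.exists_le_ker_of_lt_top _ (lt_top_iff_ne_top.2 hne)
    refine hf (LinearMap.toContinuousLinearMap.map_eq_zero_iff.1 (hdual _ fun y hy ↦ ?_))
    exact (LinearMap.mem_ker.1 (hle (Submodule.subset_span hy))).le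
  have hint : (interior C).Nonempty := by
    rw [hconv.interior_nonempty_iff_affineSpan_eq_top,
      AffineSubspace.affineSpan_eq_top_iff_vectorSpan_eq_top_of_nonempty ℝ E E ⟨0, h0⟩,
      vectorSpan_eq_span_vsub_set_right ℝ h0]
    simpa using hspan
  refine eq_univ_of_forall fun y ↦ ?_
  by_contra hy
  obtain ⟨f, hf⟩ := geometric_hahn_banach_open_point hconv.interior isOpen_interior
    fun h ↦ hy (interior_subset h)
  have hle : ∀ z ∈ C, f z ≤ f y := fun z hz ↦
    closure_minimal (fun w hw ↦ (hf w hw).le) (isClosed_le f.continuous continuous_const)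
      (hconv.closure_interior_eq_closure_of_nonempty_interior hint ▸ subset_closure hz)
  have hzero : f = 0 := hdual f fun z hz ↦ by
    by_contra! hpos
    have hy0 : 0 ≤ f y := by simpa using hle 0 h0
    have := hle (((f y + 1) / f z) • z) (hsmul _ (by positivity) z hz)
    rw [map_smul, smul_eq_mul, div_mul_cancel₀ _ hpos.ne'] at this
    linarith
  obtain ⟨w, hw⟩ := hint
  simpa [hzero] using hf w hw

/-- A conic combination of controls with values in dilations of the convex set `U` takes values in
a dilation of `U`. -/
lemma Convex.sum_smul_mem_smul {V ι : Type*} [AddCommGroup V] [Module ℝ V] {U : Set V}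
    (hU : Convex ℝ U) (hU0 : 0 ∈ U) (s : Finset ι) {c R : ι → ℝ} {w : ι → V}
    (hc : ∀ i, 0 ≤ c i) (hR : ∀ i, 0 ≤ R i) (hw : ∀ i, w i ∈ R i • U) :
    ∑ i ∈ s, c i • w i ∈ (∑ i ∈ s, c i * R i) • U := by
  classical
  induction s using Finset.induction_on with
  | empty => exact ⟨0, hU0, by simp⟩
  | insert i s hi ih =>
    rw [Finset.sum_insert hi, Finset.sum_insert hi,
      hU.add_smul (mul_nonneg (hc i) (hR i)) (Finset.sum_nonneg fun j _ ↦ mul_nonneg (hc j) (hR j))]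
    exact Set.add_mem_add (mul_smul (c i) (R i) U ▸ Set.smul_mem_smul_set (hw i)) ih

lemma Convex.smul_subset_smul {V : Type*} [AddCommGroup V] [Module ℝ V] {U : Set V}
    (hU : Convex ℝ U) (hU0 : 0 ∈ U) {a b : ℝ} (ha : 0 ≤ a) (hab : a ≤ b) : a • U ⊆ b • U := by
  have h := hU.add_smul ha (sub_nonneg.2 hab)
  rw [add_sub_cancel] at h
  rw [h]
  exact fun y hy ↦ ⟨y, hy, 0, ⟨0, hU0, smul_zero _⟩, add_zero y⟩

/-- The linear map sending a control value `u` to `∑ k, u k • (exp(−τX⁰)_* X^k)(z)`. -/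
def pushfCLM {d m : ℕ} (φ : ℝ → Ed d → Ed d) (X : Fin m → Ed d → Ed d) (τ : ℝ) (z : Ed d) :
    (Fin m → ℝ) →L[ℝ] Ed d :=
  ∑ k, (ContinuousLinearMap.proj k : (Fin m → ℝ) →L[ℝ] ℝ).smulRight (pushf φ (X k) τ z)

lemma pushfCLM_apply {d m : ℕ} (φ : ℝ → Ed d → Ed d) (X : Fin m → Ed d → Ed d) (τ : ℝ) (z : Ed d)
    (u : Fin m → ℝ) : pushfCLM φ X τ z u = ∑ k, u k • pushf φ (X k) τ z := by
  simp [pushfCLM]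

section Flow

variable {d m : ℕ} {X0 : Ed d → Ed d} {X : Fin m → Ed d → Ed d} {φ : ℝ → Ed d → Ed d}

lemma contDiff_flow_time (hφsmooth : ContDiff ℝ (⊤ : ℕ∞) (fun p : ℝ × Ed d => φ p.1 p.2)) (t : ℝ) :
    ContDiff ℝ (⊤ : ℕ∞) (φ t) :=
  hφsmooth.comp (contDiff_const.prodMk contDiff_id)

lemma contDiff_pushfCLM (hX : ∀ k, ContDiff ℝ (⊤ : ℕ∞) (X k))
    (hφsmooth : ContDiff ℝ (⊤ : ℕ∞) (fun p : ℝ × Ed d => φ p.1 p.2)) :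
    ContDiff ℝ (⊤ : ℕ∞) (fun p : ℝ × Ed d ↦ pushfCLM φ X p.1 p.2) := by
  have hpush : ∀ k, ContDiff ℝ (⊤ : ℕ∞) (fun p : ℝ × Ed d ↦ pushf φ (X k) p.1 p.2) := fun k ↦
    ContDiff.fderiv_apply (f := fun (p : ℝ × Ed d) z ↦ φ (-p.1) z)
      (hφsmooth.comp (contDiff_fst.fst.neg.prodMk contDiff_snd))
      hφsmooth ((hX k).comp hφsmooth) le_rfl
  exact ContDiff.sum fun k _ ↦ contDiff_const.smulRight (hpush k)

lemma fderiv_flow (hφsmooth : ContDiff ℝ (⊤ : ℕ∞) (fun p : ℝ × Ed d => φ p.1 p.2))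
    (hφder : ∀ t x, HasDerivAt (fun τ => φ τ x) (X0 (φ t x)) t) (t : ℝ) (z : Ed d) :
    fderiv ℝ (fun p : ℝ × Ed d => φ p.1 p.2) (t, z) =
      ((ContinuousLinearMap.fst ℝ ℝ (Ed d)).smulRight (X0 (φ t z)) +
        (fderiv ℝ (φ t) z).comp (ContinuousLinearMap.snd ℝ ℝ (Ed d))) := by
  have hD : HasFDerivAt (fun p : ℝ × Ed d => φ p.1 p.2) _ (t, z) :=
    (hφsmooth.differentiable (by simp) (t, z)).hasFDerivAt
  have h1 : fderiv ℝ (fun p : ℝ × Ed d => φ p.1 p.2) (t, z) (1, 0) = X0 (φ t z) :=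
    (hD.comp_hasDerivAt (f := fun τ ↦ (τ, z)) t
      ((hasDerivAt_id t).prodMk (hasDerivAt_const t z))).unique (hφder t z)
  have h2 : fderiv ℝ (φ t) z = (fderiv ℝ (fun p : ℝ × Ed d => φ p.1 p.2) (t, z)).comp
      (ContinuousLinearMap.inr ℝ ℝ (Ed d)) :=
    (hD.comp z (hasFDerivAt_prodMk_right t z)).fderiv
  refine ContinuousLinearMap.ext fun ⟨s, h⟩ ↦ ?_
  have e : ((s, h) : ℝ × Ed d) = s • (1, 0) + (0, h) := by simp
  rw [e, map_add, map_smul, h1, h2]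
  simp

lemma fderiv_flow_pushf (hφsmooth : ContDiff ℝ (⊤ : ℕ∞) (fun p : ℝ × Ed d => φ p.1 p.2))
    (hφ0 : ∀ x, φ 0 x = x) (hφadd : ∀ s t x, φ (s + t) x = φ s (φ t x)) (Z : Ed d → Ed d)
    (t : ℝ) (z : Ed d) : fderiv ℝ (φ t) z (pushf φ Z t z) = Z (φ t z) := by
  have hd : ∀ s w, DifferentiableAt ℝ (φ s) w := fun s w ↦
    (contDiff_flow_time hφsmooth s).differentiable (by simp) w
  have hinv : φ (-t) (φ t z) = z := by rw [← hφadd, neg_add_cancel, hφ0]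
  have hcomp : φ t ∘ φ (-t) = id := by
    ext1 w
    simp [← hφadd, hφ0]
  have := fderiv_comp (φ t z) (hd t (φ (-t) (φ t z))) (hd (-t) (φ t z))
  rw [hcomp, fderiv_id, hinv] at this
  exact (DFunLike.congr_fun this (Z (φ t z))).symm

/-- Solutions of the system pulled back by the flow of `X⁰` give points of the accessible set. -/
lemma flow_mem_access (hX0 : ContDiff ℝ (⊤ : ℕ∞) X0) (hX : ∀ k, ContDiff ℝ (⊤ : ℕ∞) (X k))
    (hφsmooth : ContDiff ℝ (⊤ : ℕ∞) (fun p : ℝ × Ed d => φ p.1 p.2))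
    (hφ0 : ∀ x, φ 0 x = x) (hφadd : ∀ s t x, φ (s + t) x = φ s (φ t x))
    (hφder : ∀ t x, HasDerivAt (fun τ => φ τ x) (X0 (φ t x)) t)
    {U : Set (Fin m → ℝ)} {T : ℝ} (hT : 0 ≤ T) {u : ℝ → Fin m → ℝ} (hu : Continuous u)
    (huU : ∀ t ∈ Icc 0 T, u t ∈ U) {z : ℝ → Ed d}
    (hz : ∀ t ∈ Icc 0 T, HasDerivWithinAt z (pushfCLM φ X t (z t) (u t)) (Icc 0 T) t) :
    φ T (z T) ∈ Access X0 X U T (z 0) := by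
  have hderiv : ∀ t ∈ Icc 0 T, HasDerivWithinAt (fun s ↦ φ s (z s))
      (X0 (φ t (z t)) + ∑ k, u t k • X k (φ t (z t))) (Icc 0 T) t := by
    intro t ht
    have hD : HasFDerivAt (fun p : ℝ × Ed d => φ p.1 p.2) _ (t, z t) :=
      (hφsmooth.differentiable (by simp) (t, z t)).hasFDerivAt
    refine (hD.comp_hasDerivWithinAt t
      ((hasDerivWithinAt_id t _).prodMk (hz t ht))).congr_deriv ?_
    rw [fderiv_flow hφsmooth hφder, pushfCLM_apply]
    simp [fderiv_flow_pushf hφsmooth hφ0 hφadd]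
  have hcont : ContinuousOn (fun s ↦ φ s (z s)) (Icc 0 T) :=
    HasDerivWithinAt.continuousOn hderiv
  have hrhs : ContinuousOn
      (fun s ↦ X0 (φ s (z s)) + ∑ k, u s k • X k (φ s (z s))) (Icc 0 T) :=
    (hX0.continuous.comp_continuousOn hcont).add <| continuousOn_finsetSum _ fun k _ ↦
      ((continuous_apply k).comp hu).continuousOn.smul
        ((hX k).continuous.comp_continuousOn hcont)
  refine ⟨fun s ↦ φ s (z s), u, ⟨hu.measurable, huU, ?_, ?_, fun t ht ↦ ?_⟩, hφ0 _, rfl⟩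
  · exact isCompact_Icc.exists_bound_of_continuousOn hu.continuousOn
  · exact hrhs.intervalIntegrable_of_Icc hT
  · have hsub : Icc 0 t ⊆ Icc 0 T := Icc_subset_Icc_right ht.2
    rw [intervalIntegral.integral_eq_sub_of_hasDerivAt_of_le (f := fun s ↦ φ s (z s)) ht.1
      (hcont.mono hsub)
      (fun s hs ↦ (hderiv s (hsub (Ioo_subset_Icc_self hs))).hasDerivAt
        (Icc_mem_nhds hs.1 (hs.2.trans_le ht.2)))
      ((hrhs.mono hsub).intervalIntegrable_of_Icc ht.1)]
    simp

/-- Under the orbital cone condition, every vector is, modulo `X⁰`, the first order effect of a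
continuous control with values in the cone generated by `U`. -/
lemma exists_control_integral_pushfCLM_eq {U : Set (Fin m → ℝ)} {x : Ed d} {T : ℝ} (hT : 0 < T)
    (hUconv : Convex ℝ U) (hU0 : (0 : Fin m → ℝ) ∈ U)
    (hcont : Continuous fun t ↦ pushfCLM φ X t x)
    (hcone : {y : Ed d | ∃ c ∈ coneHull (EIcc φ X U 0 T x), ∃ lam : ℝ, y = c + lam • X0 x}
      = univ) (y : Ed d) :
    ∃ v : ℝ → Fin m → ℝ, ∃ R s : ℝ, Continuous v ∧ 0 ≤ R ∧ (∀ t ∈ Icc 0 T, v t ∈ R • U) ∧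
      (∫ t in (0 : ℝ)..T, pushfCLM φ X t x (v t)) + s • X0 x = y := by
  have hint : ∀ v : ℝ → Fin m → ℝ, Continuous v →
      IntervalIntegrable (fun t ↦ pushfCLM φ X t x (v t)) volume 0 T := fun v hv ↦
    (hcont.clm_apply hv).intervalIntegrable _ _
  have hX0C : ∀ s : ℝ, ∃ v : ℝ → Fin m → ℝ, ∃ R s' : ℝ, Continuous v ∧ 0 ≤ R ∧
      (∀ t ∈ Icc 0 T, v t ∈ R • U) ∧
      (∫ t in (0 : ℝ)..T, pushfCLM φ X t x (v t)) + s' • X0 x = s • X0 x := fun s ↦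
    ⟨0, 0, s, continuous_const, le_rfl, fun t _ ↦ ⟨0, hU0, by simp⟩, by simp⟩
  suffices h : {y | ∃ v : ℝ → Fin m → ℝ, ∃ R s : ℝ, Continuous v ∧ 0 ≤ R ∧
      (∀ t ∈ Icc 0 T, v t ∈ R • U) ∧
      (∫ t in (0 : ℝ)..T, pushfCLM φ X t x (v t)) + s • X0 x = y} = univ from
    (Set.ext_iff.1 h y).2 (mem_univ y)
  apply eq_univ_of_forall_dual_nonpos_eq_zero
  · simpa using hX0C 0
  · rintro _ ⟨v, R, s, hv, hR, hvU, rfl⟩ _ ⟨v', R', s', hv', hR', hvU', rfl⟩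
    refine ⟨v + v', R + R', s + s', hv.add hv', add_nonneg hR hR', fun t ht ↦ ?_, ?_⟩
    · rw [hUconv.add_smul hR hR']
      exact Set.add_mem_add (hvU t ht) (hvU' t ht)
    · simp only [Pi.add_apply, map_add]
      rw [intervalIntegral.integral_add (hint v hv) (hint v' hv'), add_smul]
      abel
  · rintro c hc _ ⟨v, R, s, hv, hR, hvU, rfl⟩
    refine ⟨c • v, c * R, c * s, hv.const_smul c, mul_nonneg hc hR, fun t ht ↦ ?_, ?_⟩
    · rw [mul_smul]
      exact Set.smul_mem_smul_set (hvU t ht)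
    · simp only [Pi.smul_apply, map_smul]
      rw [intervalIntegral.integral_smul, smul_add, mul_smul]
  · intro f hf
    have hfX0 : f (X0 x) = 0 := by
      have h1 := hf _ (hX0C 1)
      have h2 := hf _ (hX0C (-1))
      simp only [one_smul, neg_smul, map_neg] at h1 h2
      linarith
    have hfE : ∀ w ∈ EIcc φ X U 0 T x, f w ≤ 0 := by
      intro w hw
      simp only [EIcc, mem_iUnion, EsetAt, mem_ofPred_eq] at hw
      obtain ⟨τ, hτ, u, hu, rfl⟩ := hw
      rw [← pushfCLM_apply]
      by_contra! hpos
      let h : ℝ → ℝ := fun t ↦ f (pushfCLM φ X t x u)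
      have hh : Continuous h := f.continuous.comp (hcont.clm_apply continuous_const)
      have hv : Continuous fun t ↦ max (h t) 0 • u := by fun_prop
      obtain ⟨R, hR⟩ := isCompact_Icc.exists_bound_of_continuousOn (hh.continuousOn (s := Icc 0 T))
      have hmem := hf _ ⟨fun t ↦ max (h t) 0 • u, max R 0, 0, hv, le_max_right _ _, fun t ht ↦
        hUconv.smul_subset_smul hU0 (le_max_right _ _)
          (max_le_max_right 0 ((le_abs_self _).trans (hR t ht))) (Set.smul_mem_smul_set hu), rfl⟩
      rw [zero_smul, add_zero, ← f.intervalIntegral_comp_comm (hint _ hv)] at hmem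
      refine hmem.not_gt (intervalIntegral.integral_pos hT ?_ (fun t _ ↦ ?_) ⟨τ, hτ, ?_⟩)
      · exact (f.continuous.comp (hcont.clm_apply hv)).continuousOn
      · rw [map_smul, map_smul, smul_eq_mul]
        change 0 ≤ max (h t) 0 * h t
        rcases le_total (h t) 0 with h0 | h0
        · simp [h0]
        · simp [h0, mul_self_nonneg]
      · rw [map_smul, map_smul, smul_eq_mul]
        exact mul_pos (lt_max_of_lt_left hpos) hpos
    have hall : ∀ w, f w ≤ 0 := by
      intro w
      obtain ⟨c, ⟨j, v, a, hv, ha, rfl⟩, lam, rfl⟩ := hcone.symm ▸ mem_univ w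
      rw [map_add, map_smul, hfX0, smul_zero, add_zero, map_sum]
      refine Finset.sum_nonpos fun i _ ↦ ?_
      rw [map_smul, smul_eq_mul]
      exact mul_nonpos_of_nonneg_of_nonpos (ha i) (hfE _ (hv i))
    ext1 w
    have h := hall (-w)
    rw [map_neg] at h
    exact le_antisymm (hall w) (by simpa using h)

end Flow

/-- For controls that depend linearly on a small parameter `p`, the solutions of the system pulled
back by the flow of `X⁰` exist, and their endpoint is strictly differentiable at `p = 0`. -/
lemma exists_pullback_solution_hasStrictFDerivAt {d m : ℕ} {X : Fin m → Ed d → Ed d}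
    {φ : ℝ → Ed d → Ed d} (hG : ContDiff ℝ (⊤ : ℕ∞) (fun p : ℝ × Ed d ↦ pushfCLM φ X p.1 p.2))
    {P : Type*} [NormedAddCommGroup P] [NormedSpace ℝ P] {V : ℝ → P →L[ℝ] (Fin m → ℝ)}
    (hV : Continuous V) {T : ℝ} (hT : 0 ≤ T) (x : Ed d) :
    ∃ z : P → ℝ → Ed d, z 0 T = x ∧ (∀ᶠ p in 𝓝 (0 : P), z p 0 = x ∧
      ∀ t ∈ Icc 0 T, HasDerivWithinAt (z p) (pushfCLM φ X t (z p t) (V t p)) (Icc 0 T) t) ∧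
      HasStrictFDerivAt (fun p ↦ z p T)
        (∫ t in (0 : ℝ)..T, (pushfCLM φ X t x).comp (V t)) 0 := by
  have hcompact : IsCompact (Icc 0 T ×ˢ closedBall x 1) :=
    isCompact_Icc.prod (isCompact_closedBall x 1)
  obtain ⟨K, hK⟩ := hG.contDiffOn.exists_lipschitzOnWith (by simp)
    ((convex_Icc 0 T).prod (convex_closedBall x 1)) hcompact
  obtain ⟨M, hM⟩ := hcompact.exists_bound_of_continuousOn hG.continuous.continuousOn
  obtain ⟨N, hN⟩ := isCompact_Icc.exists_bound_of_continuousOn (hV.continuousOn (s := Icc 0 T))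
  refine exists_solution_hasStrictFDerivAt (a := 1) (K := K * N.toNNReal)
    (M := M.toNNReal * N.toNNReal) (A := fun t z ↦ (pushfCLM φ X t z).comp (V t)) hT one_pos
    (fun z ↦ ?_) (fun t ht ↦ LipschitzOnWith.of_dist_le_mul fun z hz w hw ↦ ?_)
    (fun t ht z hz ↦ ?_)
  · exact (hG.continuous.comp (by fun_prop : Continuous fun t : ℝ ↦ (t, z))).clm_comp hV
  · have h := hK.dist_le_mul (t, z) ⟨ht, hz⟩ (t, w) ⟨ht, hw⟩
    rw [dist_eq_norm] at h ⊢
    rw [← ContinuousLinearMap.sub_comp]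
    refine (ContinuousLinearMap.opNorm_comp_le _ _).trans ?_
    calc _ ≤ (K * dist (t, z) (t, w)) * N.toNNReal :=
          mul_le_mul h ((hN t ht).trans (Real.le_coe_toNNReal N)) (norm_nonneg _) (by positivity)
      _ = _ := by
        rw [Prod.dist_eq]
        simp only [dist_self, dist_nonneg, sup_of_le_right]
        push_cast
        ring
  · refine (ContinuousLinearMap.opNorm_comp_le _ _).trans ?_
    exact mul_le_mul ((hM (t, z) ⟨ht, hz⟩).trans (Real.le_coe_toNNReal M))
      ((hN t ht).trans (Real.le_coe_toNNReal N)) (norm_nonneg _) (NNReal.coe_nonneg _)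

/-- Theorem 3.7, part II: orbital local controllability over one period. Under the
periodicity assumption, if `cone E^U(x)` together with the line `ℝ·X⁰(x)` fills `ℝ^d`,
then for every `ε > 0` the flow-saturation of `A^{εU}_{T(x)}(x)` is a neighborhood
of `x`. -/
theorem orbital_local_controllability_one_period
    {d m : ℕ}
    (X0 : Ed d → Ed d) (X : Fin m → Ed d → Ed d) (U : Set (Fin m → ℝ))
    (hX0 : ContDiff ℝ (⊤ : ℕ∞) X0) (hX : ∀ k, ContDiff ℝ (⊤ : ℕ∞) (X k))
    (hUconv : Convex ℝ U) (hUcomp : IsCompact U) (hU0 : (0 : Fin m → ℝ) ∈ U)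
    (hUspan : Submodule.span ℝ U = ⊤)
    (φ : ℝ → Ed d → Ed d)
    (hφsmooth : ContDiff ℝ (⊤ : ℕ∞) (fun p : ℝ × Ed d => φ p.1 p.2))
    (hφ0 : ∀ x, φ 0 x = x)
    (hφadd : ∀ s t x, φ (s + t) x = φ s (φ t x))
    (hφder : ∀ t x, HasDerivAt (fun τ => φ τ x) (X0 (φ t x)) t)
    (T : Ed d → ℝ)
    (hT : ∀ x, 0 < T x ∧ φ (T x) x = x ∧ ∀ t, 0 < t → φ t x = x → T x ≤ t)
    (hneq : ∀ x, X0 x ≠ 0)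
    (x : Ed d)
    (hcone : {y : Ed d | ∃ c ∈ coneHull (EIcc φ X U 0 (T x) x), ∃ lam : ℝ, y = c + lam • X0 x}
      = univ) :
    ∀ ε : ℝ, 0 < ε →
      {y : Ed d | ∃ s : ℝ, φ s y ∈ Access X0 X (ε • U) (T x) x} ∈ nhds x := by
  intro ε hε
  obtain ⟨hTpos, -, -⟩ := hT x
  have hG := contDiff_pushfCLM hX hφsmooth
  have hGx : Continuous fun t ↦ pushfCLM φ X t x :=
    hG.continuous.comp (by fun_prop : Continuous fun t : ℝ ↦ (t, x))
  choose v R s hv hR hvU hvs using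
    exists_control_integral_pushfCLM_eq hTpos hUconv hU0 hGx hcone
  let e : Option (Fin d) → Ed d := fun i ↦
    i.elim (-∑ j, EuclideanSpace.single j 1) fun j ↦ EuclideanSpace.single j 1
  let c : Option (Fin d) → ℝ × Ed d →L[ℝ] ℝ := fun i ↦
    i.elim (.fst ℝ ℝ (Ed d)) fun j ↦
      .fst ℝ ℝ (Ed d) + (EuclideanSpace.proj j).comp (.snd ℝ ℝ (Ed d))
  have hce : ∀ p, ∑ i, c i p • e i = p.2 := by
    intro p
    ext j
    simp [Fintype.sum_option, c, e, add_smul, Finset.sum_add_distrib, ← Finset.smul_sum,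
      Finset.sum_apply, Pi.single_apply]
  have hc0 : ∀ r : ℝ, ∀ w : Ed d, ‖w‖ ≤ r → ∀ i, 0 ≤ c i (r, w) := by
    rintro r w hw (_ | j)
    · exact (norm_nonneg w).trans hw
    · have h := (PiLp.norm_apply_le w j).trans hw
      have := (abs_le.1 h).1
      change 0 ≤ r + w j
      linarith
  let V : ℝ → ℝ × Ed d →L[ℝ] (Fin m → ℝ) := fun t ↦ ∑ i, (c i).smulRight (v (e i) t)
  have hVapp : ∀ t p, V t p = ∑ i, c i p • v (e i) t := fun t p ↦ by simp [V]
  have hV : Continuous V := continuous_finsetSum _ fun i _ ↦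
    (ContinuousLinearMap.smulRightL ℝ _ _ (c i)).continuous.comp (hv (e i))
  let S : ℝ × Ed d →L[ℝ] ℝ := ∑ i, s (e i) • c i
  obtain ⟨z, hz0, hz, hzD⟩ := exists_pullback_solution_hasStrictFDerivAt hG hV hTpos.le x
  have hF : HasStrictFDerivAt (fun p ↦ φ (S p) (z p (T x))) (ContinuousLinearMap.snd ℝ ℝ (Ed d)) 0 := by
    have hΦ : HasStrictFDerivAt (fun p : ℝ × Ed d => φ p.1 p.2) _ (S 0, z 0 (T x)) :=
      hφsmooth.contDiffAt.hasStrictFDerivAt (by simp)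
    refine (hΦ.comp (0 : ℝ × Ed d) (S.hasStrictFDerivAt.prodMk hzD)).congr_fderiv ?_
    rw [fderiv_flow hφsmooth hφder, map_zero, hz0, hφ0, show φ 0 = id from funext hφ0, fderiv_id]
    refine ContinuousLinearMap.ext fun p ↦ ?_
    have hint : (∫ t in (0 : ℝ)..T x, (pushfCLM φ X t x).comp (V t)) p =
        ∑ i, c i p • ∫ t in (0 : ℝ)..T x, pushfCLM φ X t x (v (e i) t) := by
      rw [ContinuousLinearMap.intervalIntegral_apply ((hGx.clm_comp hV).intervalIntegrable _ _)]
      simp only [ContinuousLinearMap.comp_apply, hVapp, map_sum, map_smul]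
      rw [intervalIntegral.integral_finsetSum (f := fun i t ↦ c i p • pushfCLM φ X t x (v (e i) t))
        fun i _ ↦ (((hGx.clm_apply (hv (e i))).const_smul (c i p)).intervalIntegrable _ _)]
      simp only [intervalIntegral.integral_smul]
    have hS : S p • X0 x = ∑ i, c i p • s (e i) • X0 x := by
      simp only [S, sum_apply, smul_apply, Finset.sum_smul,
        smul_smul, smul_eq_mul, mul_comm]
    change S p • X0 x + (∫ t in (0 : ℝ)..T x, (pushfCLM φ X t x).comp (V t)) p = p.2
    rw [hint, hS, ← Finset.sum_add_distrib, ← hce p]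
    refine Finset.sum_congr rfl fun i _ ↦ ?_
    rw [← smul_add, add_comm, hvs]
  have hsmall : ∀ᶠ p in 𝓝 (0 : ℝ × Ed d), ∑ i, c i p * R (e i) ≤ ε := by
    have h : Continuous fun p ↦ ∑ i, c i p * R (e i) := by fun_prop
    have h0 := h.tendsto 0
    simp only [map_zero, zero_mul, Finset.sum_const_zero] at h0
    exact (h0.eventually_lt_const hε).mono fun _ h ↦ h.le
  obtain ⟨δ, hδ, hball⟩ := Metric.eventually_nhds_iff_ball.1 (hz.and hsmall)
  obtain ⟨r, himage, hr0, hrδ⟩ := ((eventually_image_mem_nhds_of_hasStrictFDerivAt_snd hF).and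
    (Ioo_mem_nhdsGT hδ)).exists
  rw [map_zero, hz0, hφ0] at himage
  refine mem_of_superset himage ?_
  rintro _ ⟨w, hw, rfl⟩
  rw [mem_closedBall_zero_iff] at hw
  obtain ⟨⟨hzx, hzder⟩, hle⟩ := hball (r, w) <| by
    rw [mem_ball_zero_iff, Prod.norm_mk, max_lt_iff, Real.norm_of_nonneg hr0.le]
    exact ⟨hrδ, hw.trans_lt hrδ⟩
  refine ⟨T x - S (r, w), ?_⟩
  rw [← hφadd, sub_add_cancel]
  have hci := hc0 r w hw
  have h := flow_mem_access (U := ε • U) hX0 hX hφsmooth hφ0 hφadd hφder hTpos.le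
    (hV.clm_apply continuous_const) (fun t ht ↦ ?_) hzder
  · rwa [hzx] at h
  rw [hVapp]
  exact hUconv.smul_subset_smul hU0
    (Finset.sum_nonneg fun i _ ↦ mul_nonneg (hci i) (hR _)) hle
    (hUconv.sum_smul_mem_smul hU0 _ hci (fun i ↦ hR _) fun i ↦ hvU _ t ht)
end
end

section
/- (Lemma 3.3, open mapping lemma.) Let k ≥ 1 and let ℝ^k_+ = {(w₁,…,w_k) ∈ ℝ^k : w_i ≥ 0 for all i} be the nonnegative orthant. Let W ⊆ ℝ^k be an open neighborhood of 0 and let G : W → ℝⁿ be a C^∞ map such that the image of ℝ^k_+ under the derivative G'(0) is all of ℝⁿ, i.e. {G'(0)·w : w ∈ ℝ^k_+} = ℝⁿ. Then for every neighborhood V of the origin in ℝ^k, the set G(V ∩ W ∩ ℝ^k_+) is a neighborhood of G(0) in ℝⁿ. -/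
open Set Filter Topology

/-- A strictly differentiable map is locally open along a cone `S` around a point, provided its
derivative is surjective and its kernel meets the interior of `S`. -/
theorem HasStrictFDerivAt.nhds_le_map_nhdsWithin_of_mem_ker
    {E F : Type*} [NormedAddCommGroup E] [NormedSpace ℝ E] [CompleteSpace E]
    [NormedAddCommGroup F] [NormedSpace ℝ F] [CompleteSpace F]
    {f : E → F} {f' : E →L[ℝ] F} {a u : E} {S : Set E}
    (hf : HasStrictFDerivAt f f' a) (hsurj : Function.Surjective f') (hu : f' u = 0)
    (hSu : S ∈ 𝓝 u) (hS : ∀ t : ℝ, 0 < t → ∀ x ∈ S, t • x ∈ S) :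
    𝓝 (f a) ≤ map f (𝓝[(fun x => x - a) ⁻¹' S] a) := by
  intro T hT
  rw [mem_map, mem_nhdsWithin_iff_exists_mem_nhds_inter] at hT
  obtain ⟨V, hV, hVT⟩ := hT
  obtain ⟨δ, hδ, hδS⟩ := Metric.nhds_basis_closedBall.mem_iff.1 hSu
  let R := f'.nonlinearRightInverseOfSurjective (LinearMap.range_eq_top.2 hsurj)
  have hR : 0 < R.nnnorm := f'.nonlinearRightInverseOfSurjective_nnnorm_pos _
  have hR' : (0 : ℝ) < (R.nnnorm : ℝ)⁻¹ := inv_pos.2 (NNReal.coe_pos.2 hR)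
  have hd : 0 < ‖u‖ + δ := by positivity
  obtain ⟨c, hc, hcR⟩ : ∃ c : NNReal, 0 < c ∧ (c : ℝ) * (‖u‖ + δ) < (R.nnnorm : ℝ)⁻¹ * δ := by
    obtain ⟨c, hc, hcR⟩ := exists_between (div_pos (mul_pos hR' hδ) hd)
    exact ⟨⟨c, hc.le⟩, hc, (lt_div_iff₀ hd).1 hcR⟩
  obtain ⟨s, hs, hfs⟩ := hf.approximates_deriv_on_nhds (Or.inr hc)
  obtain ⟨r, hr, hrs⟩ := Metric.nhds_basis_closedBall.mem_iff.1 (inter_mem hs hV)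
  set t := r / (‖u‖ + δ)
  have ht0 : 0 < t := div_pos hr hd
  have htr : t * (‖u‖ + δ) = r := div_mul_cancel₀ _ hd.ne'
  have hball : Metric.closedBall (a + t • u) (t * δ) ⊆ Metric.closedBall a r := by
    apply Metric.closedBall_subset_closedBall'
    rw [dist_self_add_left, norm_smul, Real.norm_of_nonneg ht0.le, ← htr]
    linarith
  have hSball : ∀ x ∈ Metric.closedBall (a + t • u) (t * δ), x - a ∈ S := by
    intro x hx
    have hmem : t⁻¹ • (x - a) ∈ S := by
      apply hδS
      have key : t⁻¹ • (x - a) - u = t⁻¹ • (x - (a + t • u)) := by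
        rw [← sub_sub, smul_sub t⁻¹ (x - a), inv_smul_smul₀ ht0.ne']
      rw [mem_closedBall_iff_norm] at hx ⊢
      rw [key, norm_smul, norm_inv, Real.norm_of_nonneg ht0.le, inv_mul_le_iff₀ ht0]
      exact hx
    simpa [smul_inv_smul₀ ht0.ne'] using hS t ht0 _ hmem
  have hsurjOn := hfs.surjOn_closedBall_of_nonlinearRightInverse R (by positivity : 0 ≤ t * δ)
    (hball.trans (hrs.trans inter_subset_left))
  have hdist : dist (f a) (f (a + t • u)) < ((R.nnnorm : ℝ)⁻¹ - c) * (t * δ) := by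
    have hmem : a + t • u ∈ s :=
      (hrs (hball (Metric.mem_closedBall_self (by positivity)))).1
    have h := hfs _ hmem _ (mem_of_mem_nhds hs)
    rw [add_sub_cancel_left, map_smul, hu, smul_zero, sub_zero, norm_smul,
      Real.norm_of_nonneg ht0.le] at h
    rw [dist_comm, dist_eq_norm]
    have := mul_lt_mul_of_pos_left hcR ht0
    linarith
  refine mem_of_superset (Metric.closedBall_mem_nhds_of_mem hdist) ?_
  intro y hy
  obtain ⟨x, hx, rfl⟩ := hsurjOn hy
  exact hVT ⟨(hrs (hball hx)).2, hSball x hx⟩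

/-- Lemma 3.3 (open mapping lemma): if `G` is a `C^∞` map on an open neighborhood `W` of
the origin of `ℝ^k` and the derivative `G'(0)` maps the nonnegative orthant onto `ℝⁿ`,
then `G(V ∩ W ∩ ℝ^k_+)` is a neighborhood of `G(0)` for every neighborhood `V` of `0`. -/
theorem open_mapping_lemma
    {k n : ℕ} (hk : 1 ≤ k)
    (W : Set (EuclideanSpace ℝ (Fin k))) (hW : IsOpen W) (h0W : (0 : EuclideanSpace ℝ (Fin k)) ∈ W)
    (G : EuclideanSpace ℝ (Fin k) → EuclideanSpace ℝ (Fin n))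
    (hG : ContDiffOn ℝ (⊤ : ℕ∞) G W)
    (hsurj : (fun w => fderiv ℝ G 0 w) ''
        {w : EuclideanSpace ℝ (Fin k) | ∀ i, 0 ≤ w i} = univ)
    (V : Set (EuclideanSpace ℝ (Fin k))) (hV : V ∈ nhds (0 : EuclideanSpace ℝ (Fin k))) :
    G '' (V ∩ W ∩ {w : EuclideanSpace ℝ (Fin k) | ∀ i, 0 ≤ w i}) ∈ nhds (G 0) := by
  have hstrict : HasStrictFDerivAt G (fderiv ℝ G 0) 0 :=
    (hG.contDiffAt (hW.mem_nhds h0W)).hasStrictFDerivAt (by simp)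
  have hex : ∀ y, ∃ w : EuclideanSpace ℝ (Fin k), (∀ i, 0 ≤ w i) ∧ fderiv ℝ G 0 w = y :=
    fun y => hsurj.ge (mem_univ y)
  let e : EuclideanSpace ℝ (Fin k) := WithLp.toLp 2 fun _ => 1
  obtain ⟨w, hw, hwe⟩ := hex (-fderiv ℝ G 0 e)
  have hpos : {x : EuclideanSpace ℝ (Fin k) | ∀ i, 0 ≤ x i} ∈ 𝓝 (w + e) := by
    have hev : ∀ᶠ x : EuclideanSpace ℝ (Fin k) in 𝓝 (w + e), ∀ i, 0 < x i := by
      refine eventually_all.2 fun i => ?_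
      have hcont : Continuous fun x : EuclideanSpace ℝ (Fin k) => x i := by fun_prop
      refine hcont.continuousAt.eventually_const_lt ?_
      have : (w + e) i = w i + 1 := rfl
      linarith [hw i]
    exact hev.mono fun x hx i => (hx i).le
  have hle := hstrict.nhds_le_map_nhdsWithin_of_mem_ker
    (fun y => (hex y).imp fun _ h => h.2) (u := w + e) (by rw [map_add, hwe, neg_add_cancel])
    hpos fun t ht x hx i => mul_nonneg ht.le (hx i)
  simp only [sub_zero, preimage_id'] at hle
  exact hle (image_mem_map (inter_mem
    (mem_nhdsWithin_of_mem_nhds (inter_mem hV (hW.mem_nhds h0W))) self_mem_nhdsWithin))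
end

section
/- (Proposition A.1: controllability of a constrained linear time-varying system.) Let A : ℝ → ℝ^{d×d} and B : ℝ → ℝ^{d×m} be smooth, let V ⊆ ℝ^m be compact with 0 ∈ V, let t₀ < t_f, and let φ be the transition matrix of A. Then the accessible set 𝖠^V_{t₀,t_f}(0) is a neighborhood of the origin in ℝ^d if and only if cone{φ(t₀,s)B(s)v : s ∈ [t₀,t_f], v ∈ V} = ℝ^d. -/
open Set MeasureTheory

noncomputable section

/-- Accessible set from `0` of the constrained linear time-varying system
`ż = A(t)z + B(t)v`, `v ∈ V`, expressed by variation of constants through the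
transition matrix `φ` of `A`. -/
def ltvAccess {d m : ℕ} (B : ℝ → Matrix (Fin d) (Fin m) ℝ)
    (φ : ℝ → ℝ → Matrix (Fin d) (Fin d) ℝ) (V : Set (Fin m → ℝ)) (t0 tf : ℝ) :
    Set (Fin d → ℝ) :=
  {z | ∃ v : ℝ → Fin m → ℝ, Measurable v ∧ (∀ s ∈ Icc t0 tf, v s ∈ V) ∧
    z = ∫ s in t0..tf, (φ tf s).mulVec ((B s).mulVec (v s))}

open Filter Topology
open scoped NNReal

section ConicHull

variable {E : Type*} [NormedAddCommGroup E] [NormedSpace ℝ E]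

theorem coneHull_eq_span (S : Set E) : coneHull S = (Submodule.span ℝ≥0 S : Set E) := by
  ext y
  simp only [coneHull, mem_ofPred_eq, SetLike.mem_coe, Submodule.mem_span_set']
  constructor
  · rintro ⟨j, v, c, hv, hc, rfl⟩
    exact ⟨j, fun i => ⟨c i, hc i⟩, fun i => ⟨v i, hv i⟩, rfl⟩
  · rintro ⟨j, c, v, rfl⟩
    exact ⟨j, fun i => v i, fun i => c i, fun i => (v i).2, fun i => (c i).2, rfl⟩

/-- A convex cone in a finite-dimensional space not contained in any closed half-space through the
origin is the whole space. -/
theorem pointedCone_eq_top_of_forall_exists_pos [FiniteDimensional ℝ E] (C : Submodule ℝ≥0 E)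
    (hC : ∀ p : E →L[ℝ] ℝ, p ≠ 0 → ∃ x ∈ C, 0 < p x) : C = ⊤ := by
  by_contra hne
  obtain ⟨y, hy⟩ : ∃ y, y ∉ C := by
    by_contra! h
    exact hne (eq_top_iff.2 fun x _ => h x)
  have hconv : Convex ℝ (C : Set E) := by
    intro x hx z hz a b ha hb _
    exact C.add_mem (C.smul_mem ⟨a, ha⟩ hx) (C.smul_mem ⟨b, hb⟩ hz)
  have hspan : Submodule.span ℝ (C : Set E) = ⊤ := by
    by_contra h
    obtain ⟨f, hf0, hf⟩ := Submodule.exists_le_ker_of_lt_top _ (lt_top_iff_ne_top.2 h)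
    obtain ⟨x, hx, hpos⟩ := hC (LinearMap.toContinuousLinearMap f) (by simpa using hf0)
    have : f x = 0 := hf (Submodule.subset_span hx)
    simp [this] at hpos
  have hint : (interior (C : Set E)).Nonempty := by
    rw [hconv.interior_nonempty_iff_affineSpan_eq_top]
    have h0 : insert (0 : E) (C : Set E) = C := insert_eq_of_mem C.zero_mem
    have := affineSpan_insert_zero (k := ℝ) (C : Set E)
    rw [h0, hspan] at this
    exact SetLike.coe_injective (by simpa using this)
  obtain ⟨f, hf⟩ := geometric_hahn_banach_open_point hconv.interior isOpen_interior
    (fun h => hy (interior_subset h))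
  have hle : ∀ x ∈ C, f x ≤ f y := by
    have hcl : closure (interior (C : Set E)) ⊆ {x | f x ≤ f y} :=
      closure_minimal (fun x hx => (hf x hx).le) (isClosed_le f.continuous continuous_const)
    intro x hx
    apply hcl
    rw [hconv.closure_interior_eq_closure_of_nonempty_interior hint]
    exact subset_closure hx
  have hf0 : f ≠ 0 := by
    rintro rfl
    obtain ⟨x, hx⟩ := hint
    simpa using hf x hx
  obtain ⟨x, hx, hpos⟩ := hC f hf0
  have hy0 : 0 ≤ f y := by simpa using hle 0 C.zero_mem
  obtain ⟨c, hc⟩ : ∃ c : ℝ≥0, (c : ℝ) = f y / f x + 1 := ⟨⟨f y / f x + 1, by positivity⟩, rfl⟩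
  have := hle _ (C.smul_mem c hx)
  rw [NNReal.smul_def, map_smul, hc, smul_eq_mul, add_mul, div_mul_cancel₀ _ hpos.ne'] at this
  linarith

theorem coneHull_eq_univ_iff [FiniteDimensional ℝ E] (S : Set E) :
    coneHull S = univ ↔ ∀ p : E →L[ℝ] ℝ, p ≠ 0 → ∃ x ∈ S, 0 < p x := by
  rw [coneHull_eq_span]
  constructor
  · intro h p hp
    by_contra! hS
    apply hp
    have hle : ∀ x, p x ≤ 0 := by
      intro x
      have hx : x ∈ Submodule.span ℝ≥0 S := by
        rw [← SetLike.mem_coe, h]; trivial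
      induction hx using Submodule.span_induction with
      | mem x hx => exact hS x hx
      | zero => simp
      | add x y _ _ hx hy => rw [map_add]; linarith
      | smul a x _ hx =>
        rw [NNReal.smul_def, map_smul]
        exact mul_nonpos_of_nonneg_of_nonpos a.2 hx
    ext x
    have h1 := hle x
    have h2 := hle (-x)
    rw [map_neg] at h2
    simp only [_root_.zero_apply]
    linarith
  · intro h
    rw [pointedCone_eq_top_of_forall_exists_pos (Submodule.span ℝ≥0 S), Submodule.top_coe]
    intro p hp
    obtain ⟨x, hx, hpos⟩ := h p hp
    exact ⟨x, Submodule.subset_span hx, hpos⟩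

/-- If a family of vectors meets every open half-space through the origin, so does a finite
subfamily. -/
theorem exists_finset_forall_exists_pos [FiniteDimensional ℝ E] {S : Set ℝ} (w : ℝ → E)
    (h : ∀ p : E →L[ℝ] ℝ, p ≠ 0 → ∃ x ∈ S, 0 < p (w x)) :
    ∃ X : Finset ℝ, ↑X ⊆ S ∧ ∀ p : E →L[ℝ] ℝ, p ≠ 0 → ∃ x ∈ X, 0 < p (w x) := by
  have hcomp : IsCompact (Metric.sphere (0 : E →L[ℝ] ℝ) 1) := isCompact_sphere _ _
  obtain ⟨X, hXS, hXfin, hX⟩ := hcomp.elim_finite_subcover_image (b := S)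
    (c := fun x => {p : E →L[ℝ] ℝ | 0 < p (w x)})
    (fun x _ => isOpen_lt continuous_const (by fun_prop))
    (by
      intro p hp
      have hp0 : p ≠ 0 := by rintro rfl; simp at hp
      obtain ⟨x, hx, hpos⟩ := h p hp0
      exact mem_iUnion₂.2 ⟨x, hx, hpos⟩)
  refine ⟨hXfin.toFinset, by simpa using hXS, fun p hp => ?_⟩
  have hn : 0 < ‖p‖ := norm_pos_iff.2 hp
  obtain ⟨x, hx, hpos⟩ := mem_iUnion₂.1 (hX (show ‖p‖⁻¹ • p ∈ Metric.sphere 0 1 by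
    simp [norm_smul, hn.ne']))
  refine ⟨x, by simpa using hx, ?_⟩
  have hpos' : 0 < ‖p‖⁻¹ * p (w x) := hpos
  exact (mul_pos_iff_of_pos_left (inv_pos.2 hn)).1 hpos'

end ConicHull

section LocalSurjectivity

variable {E ι : Type*} [NormedAddCommGroup E] [NormedSpace ℝ E] [FiniteDimensional ℝ E]
  [Fintype ι]

/-- A map on `ℝ^ι` whose derivative at `0` is onto and kills a vector with positive entries is
locally onto when restricted to small cubes of the nonnegative orthant. -/
theorem image_nonneg_cube_mem_nhds {F : (ι → ℝ) → E} {W : (ι → ℝ) →L[ℝ] E}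
    (hF : HasStrictFDerivAt F W 0) (hF0 : F 0 = 0) (hW : W.range = ⊤)
    {e : ι → ℝ} (he : ∀ i, 1 ≤ e i) (hWe : W e = 0) {δ : ℝ} (hδ : 0 < δ) :
    F '' {x | ∀ i, x i ∈ Icc 0 δ} ∈ 𝓝 (0 : E) := by
  have : CompleteSpace E := FiniteDimensional.complete ℝ E
  set R := W.nonlinearRightInverseOfSurjective hW with hR
  have hRpos : 0 < (R.nnnorm : ℝ) := W.nonlinearRightInverseOfSurjective_nnnorm_pos hW
  obtain ⟨c, hc0, hc⟩ : ∃ c : ℝ, 0 < c ∧ c * (‖e‖ + 1) < (R.nnnorm : ℝ)⁻¹ := by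
    have hp : 0 < ‖e‖ + 1 := by positivity
    refine ⟨(R.nnnorm : ℝ)⁻¹ / (‖e‖ + 1) / 2, by positivity, ?_⟩
    rw [div_mul_eq_mul_div, div_mul_cancel₀ _ hp.ne']
    exact half_lt_self (by positivity)
  obtain ⟨s, hs, happ⟩ := hF.approximates_deriv_on_nhds (c := ⟨c, hc0.le⟩) (Or.inr hc0)
  obtain ⟨r, hr, hrs⟩ := Metric.mem_nhds_iff.1 hs
  obtain ⟨t, ht0, ht⟩ : ∃ t : ℝ, 0 < t ∧ t * (‖e‖ + 1) < min r δ := by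
    have hp : 0 < ‖e‖ + 1 := by positivity
    have hm : 0 < min r δ := lt_min hr hδ
    refine ⟨min r δ / (‖e‖ + 1) / 2, by positivity, ?_⟩
    rw [div_mul_eq_mul_div, div_mul_cancel₀ _ hp.ne']
    exact half_lt_self hm
  have hnorm : ∀ x ∈ Metric.closedBall (t • e) t, ‖x‖ ≤ t * (‖e‖ + 1) := by
    intro x hx
    have h1 : ‖x - t • e‖ ≤ t := by simpa [dist_eq_norm] using hx
    have h2 : ‖t • e‖ = t * ‖e‖ := by rw [norm_smul, Real.norm_of_nonneg ht0.le]
    calc ‖x‖ = ‖(x - t • e) + t • e‖ := by simp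
      _ ≤ ‖x - t • e‖ + ‖t • e‖ := norm_add_le _ _
      _ ≤ t * (‖e‖ + 1) := by rw [h2]; linarith
  have hball : Metric.closedBall (t • e) t ⊆ s := fun x hx => hrs (by
    rw [mem_ball_zero_iff]
    exact (hnorm x hx).trans_lt (ht.trans_le (min_le_left _ _)))
  have hsurj := happ.surjOn_closedBall_of_nonlinearRightInverse R ht0.le hball
  have hFe : ‖F (t • e)‖ ≤ c * (t * ‖e‖) := by
    have h := happ _ (hball (Metric.mem_closedBall_self ht0.le)) _ (mem_of_mem_nhds hs)
    rw [hF0, sub_zero, sub_zero, map_smul, hWe, smul_zero, sub_zero, norm_smul,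
      Real.norm_of_nonneg ht0.le] at h
    exact h
  have hsub : F '' Metric.closedBall (t • e) t ⊆ F '' {x | ∀ i, x i ∈ Icc 0 δ} := by
    refine image_mono fun x hx i => ⟨?_, ?_⟩
    · have h1 : ‖x - t • e‖ ≤ t := by simpa [dist_eq_norm] using hx
      have h2 := (abs_le.1 ((norm_le_pi_norm (x - t • e) i).trans h1)).1
      simp only [Pi.sub_apply, Pi.smul_apply, smul_eq_mul] at h2
      nlinarith [he i]
    · have h2 := (abs_le.1 ((norm_le_pi_norm x i).trans (hnorm x hx))).2
      exact h2.trans (ht.le.trans (min_le_right _ _))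
  refine mem_of_superset ?_ (Subset.trans hsurj hsub)
  refine mem_of_superset (Metric.isOpen_ball.mem_nhds ?_) Metric.ball_subset_closedBall
  rw [Metric.mem_ball, dist_eq_norm, zero_sub, norm_neg]
  refine hFe.trans_lt ?_
  have : c * ‖e‖ < (R.nnnorm : ℝ)⁻¹ - c := by linarith
  change c * (t * ‖e‖) < ((R.nnnorm : ℝ)⁻¹ - c) * t
  nlinarith

end LocalSurjectivity

section DenseLevels

/-- There is a function `ℝ → ℕ` all of whose level sets are dense. -/
theorem exists_nat_valued_dense_levels :
    ∃ u : ℝ → ℕ, ∀ k : ℕ, ∀ a b : ℝ, a < b → ∃ x ∈ Ioo a b, u x = k := by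
  classical
  let P : ℝ → ℕ → Prop := fun x k => ∃ q : ℚ, x = q + k * √2
  have huniq : ∀ x k l, P x k → P x l → k = l := by
    rintro x k l ⟨q, rfl⟩ ⟨q', h⟩
    by_contra hne
    have hne' : ((k : ℤ) - l : ℤ) ≠ 0 := by omega
    have := (irrational_sqrt_two.intCast_mul hne').ne_rat (q' - q)
    apply this
    push_cast
    linarith
  refine ⟨fun x => if h : ∃ k, P x k then h.choose else 0, fun k a b hab => ?_⟩
  obtain ⟨q, hq1, hq2⟩ := exists_rat_btwn (show a - k * √2 < b - k * √2 by linarith)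
  refine ⟨q + k * √2, ⟨by linarith, by linarith⟩, ?_⟩
  have h : ∃ k', P (q + k * √2) k' := ⟨k, q, rfl⟩
  refine (dif_pos h).trans ?_
  exact huniq _ _ _ h.choose_spec ⟨q, rfl⟩

end DenseLevels

section IntegralReach

variable {E F : Type*} [NormedAddCommGroup E] [NormedSpace ℝ E]
  [MeasurableSpace F]

/-- The set of integrals `∫ H(s, v(s)) ds` over measurable `V`-valued `v`. -/
def integralReach (H : ℝ → F → E) (V : Set F) (a b : ℝ) : Set E :=
  {z | ∃ v : ℝ → F, Measurable v ∧ (∀ s ∈ Icc a b, v s ∈ V) ∧ z = ∫ s in a..b, H s (v s)}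

theorem exists_pos_of_integralReach_mem_nhds [CompleteSpace E] {H : ℝ → F → E} {V : Set F}
    {a b : ℝ} (hab : a ≤ b)
    (h : integralReach H V a b ∈ 𝓝 (0 : E)) (p : E →L[ℝ] ℝ) (hp : p ≠ 0) :
    ∃ s ∈ Icc a b, ∃ v ∈ V, 0 < p (H s v) := by
  by_contra! hle
  have hz : ∀ z ∈ integralReach H V a b, p z ≤ 0 := by
    rintro z ⟨v, -, hv, rfl⟩
    by_cases hint : IntervalIntegrable (fun s => H s (v s)) volume a b
    · rw [← p.intervalIntegral_comp_comm hint, intervalIntegral.integral_of_le hab]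
      refine setIntegral_nonpos measurableSet_Ioc fun s hs => ?_
      exact hle s (Ioc_subset_Icc_self hs) _ (hv s (Ioc_subset_Icc_self hs))
    · rw [intervalIntegral.integral_undef hint, map_zero]
  obtain ⟨x, hx⟩ : ∃ x, 0 < p x := by
    by_contra! hx
    apply hp
    ext x
    have h2 := hx (-x)
    rw [map_neg] at h2
    exact le_antisymm (hx x) (by simpa using h2)
  have hlim : Tendsto (fun t : ℝ => t • x) (𝓝[>] 0) (𝓝 0) := by
    have : Tendsto (fun t : ℝ => t • x) (𝓝 0) (𝓝 ((0 : ℝ) • x)) :=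
      (continuous_id.smul continuous_const).tendsto 0
    rw [zero_smul] at this
    exact this.mono_left nhdsWithin_le_nhds
  obtain ⟨t, ht, ht0⟩ := ((hlim.eventually h).and self_mem_nhdsWithin).exists
  have := hz _ ht
  rw [map_smul, smul_eq_mul] at this
  exact absurd this (not_le.2 (mul_pos ht0 hx))

theorem exists_pos_disjoint_width (X : Finset ℝ) {b : ℝ} (hX : ∀ x ∈ X, x < b) :
    ∃ δ > 0, (∀ x ∈ X, x + δ ≤ b) ∧ ∀ x ∈ X, ∀ y ∈ X, x < y → x + δ ≤ y := by
  have key : ∀ x y : ℝ, x < y → ∀ᶠ δ in 𝓝[>] (0 : ℝ), x + δ ≤ y := by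
    intro x y hxy
    filter_upwards [Ioo_mem_nhdsGT (sub_pos.2 hxy)] with δ hδ
    linarith [hδ.2]
  have h1 : ∀ᶠ δ in 𝓝[>] (0 : ℝ), ∀ x ∈ X, x + δ ≤ b :=
    (eventually_all_finset X).2 fun x hx => key x b (hX x hx)
  have h2 : ∀ᶠ δ in 𝓝[>] (0 : ℝ), ∀ x ∈ X, ∀ y ∈ X, x < y → x + δ ≤ y := by
    refine (eventually_all_finset X).2 fun x _ => (eventually_all_finset X).2 fun y _ => ?_
    by_cases hxy : x < y
    · exact (key x y hxy).mono fun δ hδ _ => hδ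
    · exact Eventually.of_forall fun δ h => absurd h hxy
  obtain ⟨δ, ⟨h1, h2⟩, h0⟩ := ((h1.and h2).and self_mem_nhdsWithin).exists
  exact ⟨δ, h0, h1, h2⟩

variable [NormedAddCommGroup F] [BorelSpace F] [SecondCountableTopology F]

theorem sum_integral_mem_integralReach {H : ℝ → F → E} (hH : Continuous (Function.uncurry H))
    (hH0 : ∀ s, H s 0 = 0) {V : Set F} (hV0 : (0 : F) ∈ V) {a b : ℝ} (hab : a ≤ b)
    {X : Finset ℝ} (hXa : ∀ x ∈ X, a ≤ x) {δ : ℝ}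
    (hXb : ∀ x ∈ X, x + δ ≤ b) (hsep : ∀ x ∈ X, ∀ y ∈ X, x < y → x + δ ≤ y)
    {u : ℝ → F} (hu : ∀ x, u x ∈ V) {ε : X → ℝ} (hε : ∀ x, ε x ∈ Icc 0 δ) :
    ∑ x : X, ∫ s in (x : ℝ)..x + ε x, H s (u x) ∈ integralReach H V a b := by
  classical
  let I : X → Set ℝ := fun x => Ioc (x : ℝ) (x + ε x)
  have hdisj : ∀ s, ∀ x y : X, s ∈ I x → s ∈ I y → x = y := by
    intro s x y hx hy
    by_contra hne
    rcases lt_or_gt_of_ne (fun h => hne (Subtype.ext h) : (x : ℝ) ≠ y) with h | h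
    · linarith [hsep x x.2 y y.2 h, hx.2, hy.1, (hε x).2]
    · linarith [hsep y y.2 x x.2 h, hy.2, hx.1, (hε y).2]
  let v : ℝ → F := fun s => ∑ x : X, (I x).indicator (fun _ => u x) s
  have hcase : ∀ s, v s ∈ V ∧ H s (v s) = ∑ x : X, (I x).indicator (fun s => H s (u x)) s := by
    intro s
    by_cases hs : ∃ x, s ∈ I x
    · obtain ⟨x, hx⟩ := hs
      have hout : ∀ y ∈ Finset.univ, y ≠ x → s ∉ I y := fun y _ hy hsy => hy (hdisj s y x hsy hx)
      have hv : v s = u x := by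
        simp only [v]
        rw [Finset.sum_eq_single x (fun y hy hyx => indicator_of_notMem (hout y hy hyx) _)
          (by simp), indicator_of_mem hx]
      rw [hv, Finset.sum_eq_single x (fun y hy hyx => indicator_of_notMem (hout y hy hyx) _)
          (by simp), indicator_of_mem hx]
      exact ⟨hu x, rfl⟩
    · push Not at hs
      have hv : v s = 0 := Finset.sum_eq_zero fun x _ => indicator_of_notMem (hs x) _
      rw [hv, hH0, Finset.sum_eq_zero fun x _ => indicator_of_notMem (hs x) _]
      exact ⟨hV0, rfl⟩
  refine ⟨v, ?_, fun s _ => (hcase s).1, ?_⟩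
  · exact Finset.measurable_sum _ fun x _ => measurable_const.indicator measurableSet_Ioc
  · have hcont : ∀ x : X, Continuous fun s => H s (u x) := fun x =>
      hH.comp (continuous_id.prodMk continuous_const)
    simp_rw [fun s => (hcase s).2]
    rw [intervalIntegral.integral_of_le hab, integral_finsetSum]
    · refine Finset.sum_congr rfl fun x _ => ?_
      rw [setIntegral_indicator measurableSet_Ioc, inter_eq_right.2,
        intervalIntegral.integral_of_le (by linarith [(hε x).1])]
      exact Ioc_subset_Ioc (hXa x x.2) (by linarith [hXb x x.2, (hε x).2])
    · intro x _
      exact ((hcont x).integrableOn_Ioc).indicator measurableSet_Ioc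

theorem integralReach_mem_nhds [FiniteDimensional ℝ E] {H : ℝ → F → E} (hH : Continuous (Function.uncurry H))
    (hH0 : ∀ s, H s 0 = 0) {V : Set F} (hV0 : (0 : F) ∈ V) {a b : ℝ} (hab : a < b)
    (h : ∀ p : E →L[ℝ] ℝ, p ≠ 0 → ∃ s ∈ Icc a b, ∃ v ∈ V, 0 < p (H s v)) :
    integralReach H V a b ∈ 𝓝 (0 : E) := by
  classical
  have : CompleteSpace E := FiniteDimensional.complete ℝ E
  have : Nonempty V := ⟨⟨0, hV0⟩⟩
  obtain ⟨k, hk⟩ := exists_nat_valued_dense_levels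
  let u : ℝ → F := fun x => (TopologicalSpace.denseSeq V (k x) : F)
  have hu : ∀ x, u x ∈ V := fun x => (TopologicalSpace.denseSeq V (k x)).2
  have hdense : ∀ p : E →L[ℝ] ℝ, p ≠ 0 → ∃ x ∈ Ioo a b, 0 < p (H x (u x)) := by
    intro p hp
    obtain ⟨s, hs, v, hv, hpos⟩ := h p hp
    have hpH : Continuous fun z : ℝ × F => p (H z.1 z.2) := p.continuous.comp hH
    obtain ⟨n, hn⟩ : ∃ n, 0 < p (H s (TopologicalSpace.denseSeq V n)) := by
      have ho : IsOpen {w : V | 0 < p (H s w)} := isOpen_lt continuous_const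
        (hpH.comp (continuous_const.prodMk continuous_subtype_val))
      obtain ⟨w, hw, n, rfl⟩ := (TopologicalSpace.denseRange_denseSeq V).inter_open_nonempty _ ho
        ⟨⟨v, hv⟩, hpos⟩
      exact ⟨n, hw⟩
    have ho : IsOpen {x : ℝ | 0 < p (H x (TopologicalSpace.denseSeq V n))} :=
      isOpen_lt continuous_const (hpH.comp (continuous_id.prodMk continuous_const))
    have hs' : s ∈ closure (Ioo a b) := by rwa [closure_Ioo hab.ne]
    obtain ⟨y, hy, hyab⟩ := mem_closure_iff.1 hs' _ ho hn
    obtain ⟨c, d, hcd, hsub⟩ := mem_nhds_iff_exists_Ioo_subset.1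
      ((ho.inter isOpen_Ioo).mem_nhds ⟨hy, hyab⟩)
    obtain ⟨x, hx, hkx⟩ := hk n c d (hcd.1.trans hcd.2)
    refine ⟨x, (hsub hx).2, ?_⟩
    have : 0 < p (H x (TopologicalSpace.denseSeq V n)) := (hsub hx).1
    simpa only [u, hkx] using this
  obtain ⟨X, hXab, hX⟩ := exists_finset_forall_exists_pos (fun x => H x (u x)) hdense
  obtain ⟨δ, hδ, hXb, hsep⟩ := exists_pos_disjoint_width X fun x hx => (hXab hx).2
  let W : (X → ℝ) →L[ℝ] E :=
    ∑ x : X, (ContinuousLinearMap.proj (R := ℝ) (φ := fun _ : X => ℝ) x).smulRight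
      (H x (u x))
  have hWapp : ∀ ε, W ε = ∑ x : X, ε x • H x (u x) := by
    intro ε
    simp [W]
  have hcone : ∀ y : E, ∃ c : X → ℝ, (∀ x, 0 ≤ c x) ∧ W c = y := by
    have htop := pointedCone_eq_top_of_forall_exists_pos
      (Submodule.span ℝ≥0 (range fun x : X => H x (u x))) (by
        intro p hp
        obtain ⟨x, hx, hpos⟩ := hX p hp
        exact ⟨_, Submodule.subset_span ⟨⟨x, hx⟩, rfl⟩, hpos⟩)
    intro y
    have hy : y ∈ Submodule.span ℝ≥0 (range fun x : X => H x (u x)) := by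
      rw [htop]; trivial
    obtain ⟨c, hc⟩ := (Submodule.mem_span_range_iff_exists_fun ℝ≥0).1 hy
    exact ⟨fun x => c x, fun x => (c x).2, by rw [hWapp]; exact hc⟩
  obtain ⟨c, hc0, hc⟩ := hcone (-W 1)
  let G : (X → ℝ) → E := fun ε => ∑ x : X, ∫ s in (x : ℝ)..x + ε x, H s (u x)
  have hG : HasStrictFDerivAt G W 0 := by
    refine HasStrictFDerivAt.fun_sum fun x _ => ?_
    have hcont : Continuous fun s => H s (u x) := hH.comp (continuous_id.prodMk continuous_const)
    have h1 : HasStrictDerivAt (fun r => ∫ s in (x : ℝ)..r, H s (u x)) (H x (u x))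
        ((x : ℝ) + (0 : X → ℝ) x) := by
      have := intervalIntegral.integral_hasStrictDerivAt_right
        (hcont.intervalIntegrable (x : ℝ) x)
        (hcont.stronglyMeasurableAtFilter _ _) hcont.continuousAt
      simpa using this
    have h2 : HasStrictFDerivAt (fun ε : X → ℝ => (x : ℝ) + ε x)
        (ContinuousLinearMap.proj (R := ℝ) (φ := fun _ : X => ℝ) x) 0 :=
      ((ContinuousLinearMap.proj (R := ℝ) (φ := fun _ : X => ℝ) x).hasStrictFDerivAt).const_add _
    have h3 := h1.hasStrictFDerivAt.comp (0 : X → ℝ) h2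
    convert h3 using 1
    ext ε
    simp
  have hmem := image_nonneg_cube_mem_nhds (F := G) (e := 1 + c) hG (by simp [G])
    (LinearMap.range_eq_top.2 fun y => (hcone y).imp fun _ h => h.2)
    (fun x => by simpa using hc0 x) (by rw [map_add, hc, add_neg_cancel]) hδ
  refine mem_of_superset hmem ?_
  rintro _ ⟨ε, hε, rfl⟩
  exact sum_integral_mem_integralReach hH hH0 hV0 hab.le (fun x hx => (hXab hx).1.le) hXb hsep
    hu hε

end IntegralReach

section Transition

open Matrix

theorem continuous_transition_snd {d : ℕ} {φ : ℝ → ℝ → Matrix (Fin d) (Fin d) ℝ}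
    (hφid : ∀ t, φ t t = 1) (hφmul : ∀ t1 t2 t3, φ t3 t2 * φ t2 t1 = φ t3 t1) (t : ℝ)
    (hφ : Continuous fun s => φ s t) : Continuous fun s => φ t s := by
  have hinv : ∀ s, φ t s = (φ s t)⁻¹ := fun s =>
    (Matrix.inv_eq_left_inv (by rw [hφmul, hφid])).symm
  have hdet : ∀ s, (φ s t).det ≠ 0 := by
    intro s h
    have := congrArg Matrix.det ((hφmul t s t).trans (hφid t))
    rw [Matrix.det_mul, h, mul_zero, Matrix.det_one] at this
    exact zero_ne_one this
  simp_rw [hinv, Matrix.inv_def, Ring.inverse_eq_inv']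
  exact (hφ.matrix_det.inv₀ hdet).smul hφ.matrix_adjugate

end Transition

/-- Proposition A.1: the accessible set `𝖠^V_{t₀,t_f}(0)` of the constrained linear
time-varying system is a neighborhood of the origin iff
`cone {φ(t₀,s)B(s)v : s ∈ [t₀,t_f], v ∈ V} = ℝ^d`. -/
theorem ltv_controllability_iff_cone
    {d m : ℕ}
    (A : ℝ → Matrix (Fin d) (Fin d) ℝ) (B : ℝ → Matrix (Fin d) (Fin m) ℝ)
    (hA : ∀ i j, ContDiff ℝ (⊤ : ℕ∞) (fun t => A t i j))
    (hB : ∀ i j, ContDiff ℝ (⊤ : ℕ∞) (fun t => B t i j))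
    (V : Set (Fin m → ℝ)) (hVcomp : IsCompact V) (hV0 : (0 : Fin m → ℝ) ∈ V)
    (t0 tf : ℝ) (ht : t0 < tf)
    (φ : ℝ → ℝ → Matrix (Fin d) (Fin d) ℝ)
    (hφid : ∀ t, φ t t = 1)
    (hφmul : ∀ t1 t2 t3, φ t3 t2 * φ t2 t1 = φ t3 t1)
    (hφder : ∀ t1 t i j, HasDerivAt (fun s => φ s t1 i j) ((A t * φ t t1) i j) t) :
    ltvAccess B φ V t0 tf ∈ nhds (0 : Fin d → ℝ) ↔
      coneHull {w : Fin d → ℝ | ∃ s ∈ Icc t0 tf, ∃ v ∈ V,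
        w = (φ t0 s).mulVec ((B s).mulVec v)} = univ := by
  have hφcont : Continuous fun s => φ s t0 := continuous_matrix fun i j =>
    continuous_iff_continuousAt.2 fun t => (hφder t0 t i j).continuousAt
  have hφcont' := continuous_transition_snd hφid hφmul t0 hφcont
  have hBcont : Continuous B := continuous_matrix fun i j => (hB i j).continuous
  let H : ℝ → (Fin m → ℝ) → (Fin d → ℝ) := fun s v => (φ tf s).mulVec ((B s).mulVec v)
  have hHeq : ∀ s v, H s v = (φ tf t0).mulVec ((φ t0 s).mulVec ((B s).mulVec v)) := by
    intro s v
    rw [Matrix.mulVec_mulVec _ (φ tf t0), hφmul]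
  have hH : Continuous (Function.uncurry H) := by
    have : Function.uncurry H = fun z : ℝ × (Fin m → ℝ) =>
        (φ tf t0).mulVec ((φ t0 z.1).mulVec ((B z.1).mulVec z.2)) :=
      funext fun z => hHeq z.1 z.2
    rw [this]
    exact continuous_const.matrix_mulVec ((hφcont'.comp continuous_fst).matrix_mulVec
      ((hBcont.comp continuous_fst).matrix_mulVec continuous_snd))
  have hreach : ltvAccess B φ V t0 tf = integralReach H V t0 tf := rfl
  let M : (Fin d → ℝ) →L[ℝ] (Fin d → ℝ) := LinearMap.toContinuousLinearMap (φ tf t0).mulVecLin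
  let N : (Fin d → ℝ) →L[ℝ] (Fin d → ℝ) := LinearMap.toContinuousLinearMap (φ t0 tf).mulVecLin
  have hM : ∀ x, M x = (φ tf t0).mulVec x := fun _ => rfl
  have hN : ∀ x, N x = (φ t0 tf).mulVec x := fun _ => rfl
  have hMN : ∀ x, M (N x) = x := fun x => by
    rw [hM, hN, Matrix.mulVec_mulVec, hφmul, hφid, Matrix.one_mulVec]
  have hNM : ∀ x, N (M x) = x := fun x => by
    rw [hM, hN, Matrix.mulVec_mulVec, hφmul, hφid, Matrix.one_mulVec]
  rw [coneHull_eq_univ_iff, hreach]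
  constructor
  · intro h p hp
    obtain ⟨s, hs, v, hv, hpos⟩ := exists_pos_of_integralReach_mem_nhds ht.le h (p.comp N) (by
      intro h0
      apply hp
      ext1 x
      have := congrArg (fun q : (Fin d → ℝ) →L[ℝ] ℝ => q (M x)) h0
      simpa [hNM] using this)
    refine ⟨_, ⟨s, hs, v, hv, rfl⟩, ?_⟩
    rwa [ContinuousLinearMap.comp_apply, hHeq, ← hM, hNM] at hpos
  · intro h
    refine integralReach_mem_nhds hH (fun s => by simp [H]) hV0 ht fun p hp => ?_
    obtain ⟨_, ⟨s, hs, v, hv, rfl⟩, hpos⟩ := h (p.comp M) (by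
      intro h0
      apply hp
      ext1 x
      have := congrArg (fun q : (Fin d → ℝ) →L[ℝ] ℝ => q (N x)) h0
      simpa [hMN] using this)
    exact ⟨s, hs, v, hv, by rwa [hHeq]⟩
end
end

section
/- (Lemma 3.4, part I: the cone condition characterizes controllability of the constrained linear approximation.) Let U ⊆ ℝ^m be compact with 0 ∈ U, let t_f > 0, let x̄₀ ∈ ℝ^d, and set Ē = E^U_{[0,t_f]}(x̄₀). Define the attainable set of the linearized system along the drift solution t ↦ φ⁰(t,x̄₀) as 𝖠^U_{0,t_f}(0) = { D_xφ⁰(t_f,·)(x̄₀) · ∫₀^{t_f} Σ_{k=1}^m u_k(s) (exp(−sX⁰)_*X^k)(x̄₀) ds : u : [0,t_f] → U measurable }. Then 𝖠^U_{0,t_f}(0) is a neighborhood of the origin in ℝ^d if and only if cone Ē = ℝ^d. -/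
open Set MeasureTheory
open scoped Pointwise

noncomputable section

/-- Attainable set at time `tf` from `0` of the linearization, with `U`-valued controls,
of the affine system along the drift solution `t ↦ φ⁰(t, x̄₀)`, expressed in terms of
pushforwards along the flow. -/
def linAttain {d m : ℕ} (φ : ℝ → Ed d → Ed d) (X : Fin m → Ed d → Ed d)
    (U : Set (Fin m → ℝ)) (tf : ℝ) (xbar0 : Ed d) : Set (Ed d) :=
  {z | ∃ u : ℝ → Fin m → ℝ, Measurable u ∧ (∀ s ∈ Icc (0:ℝ) tf, u s ∈ U) ∧
    z = fderiv ℝ (fun y => φ tf y) xbar0 (∫ s in (0:ℝ)..tf, ∑ k, u s k • pushf φ (X k) s xbar0)}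

section ConicHull

variable {V : Type*}

theorem zero_mem_coneHull [AddCommMonoid V] [Module ℝ V] (S : Set V) : (0 : V) ∈ coneHull S :=
  ⟨0, Fin.elim0, Fin.elim0, fun i => i.elim0, fun i => i.elim0, by simp⟩

theorem subset_coneHull [AddCommMonoid V] [Module ℝ V] (S : Set V) : S ⊆ coneHull S :=
  fun x hx => ⟨1, fun _ => x, fun _ => 1, fun _ => hx, fun _ => zero_le_one, by simp⟩

theorem add_mem_coneHull [AddCommMonoid V] [Module ℝ V] {S : Set V} {x y : V}
    (hx : x ∈ coneHull S) (hy : y ∈ coneHull S) : x + y ∈ coneHull S := by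
  obtain ⟨j, v, c, hv, hc, rfl⟩ := hx
  obtain ⟨k, w, e, hw, he, rfl⟩ := hy
  refine ⟨j + k, Fin.append v w, Fin.append c e, fun i => ?_, fun i => ?_, ?_⟩
  · induction i using Fin.addCases <;> simp [hv, hw]
  · induction i using Fin.addCases <;> simp [hc, he]
  · simp [Fin.sum_univ_add]

theorem smul_mem_coneHull [AddCommMonoid V] [Module ℝ V] {S : Set V} {a : ℝ} (ha : 0 ≤ a) {x : V}
    (hx : x ∈ coneHull S) : a • x ∈ coneHull S := by
  obtain ⟨j, v, c, hv, hc, rfl⟩ := hx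
  exact ⟨j, v, fun i => a * c i, hv, fun i => mul_nonneg ha (hc i), by
    simp [Finset.smul_sum, mul_smul]⟩

theorem convex_coneHull [AddCommMonoid V] [Module ℝ V] (S : Set V) : Convex ℝ (coneHull S) :=
  fun _ hx _ hy _ _ ha hb _ => add_mem_coneHull (smul_mem_coneHull ha hx) (smul_mem_coneHull hb hy)

theorem coneHull_subset_span [AddCommMonoid V] [Module ℝ V] (S : Set V) :
    coneHull S ⊆ (Submodule.span ℝ S : Set V) := by
  rintro _ ⟨j, v, c, hv, -, rfl⟩
  exact Submodule.sum_mem _ fun i _ => Submodule.smul_mem _ _ (Submodule.subset_span (hv i))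

/-- A set whose conic hull is everything contains a finite spanning family having a vanishing
linear combination with strictly positive coefficients. -/
theorem exists_pos_combination_eq_zero [AddCommGroup V] [Module ℝ V] [FiniteDimensional ℝ V]
    {S : Set V} (hS : coneHull S = univ) :
    ∃ (n : ℕ) (v : Fin n → V) (c : Fin n → ℝ), (∀ i, v i ∈ S) ∧ (∀ i, 0 < c i) ∧
      ∑ i, c i • v i = 0 ∧ Submodule.span ℝ (range v) = ⊤ := by
  have hspan : ⊤ ≤ Submodule.span ℝ S := fun x _ =>
    coneHull_subset_span S (hS ▸ mem_univ x)
  let b := Module.Basis.ofSpan hspan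
  have : Finite ((linearIndepOn_empty ℝ (id : V → V)).extend (empty_subset S)) :=
    Module.Finite.finite_basis b
  let : Fintype ((linearIndepOn_empty ℝ (id : V → V)).extend (empty_subset S)) :=
    Fintype.ofFinite _
  have hb : ∀ i, b i ∈ S := fun i => Module.Basis.ofSpan_subset hspan ⟨i, rfl⟩
  have hw : -∑ i, b i ∈ coneHull S := hS ▸ mem_univ _
  obtain ⟨j, w, e, hw, he, hsum⟩ := hw
  let κ := ((linearIndepOn_empty ℝ (id : V → V)).extend (empty_subset S)) ⊕ {i // 0 < e i}
  let σ : Fin (Fintype.card κ) ≃ κ := (Fintype.equivFin κ).symm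
  let v : κ → V := Sum.elim b fun i => w i
  let c : κ → ℝ := Sum.elim 1 fun i => e i
  refine ⟨Fintype.card κ, v ∘ σ, c ∘ σ, fun i => ?_, fun i => ?_, ?_, ?_⟩
  · rcases h : σ i with k | k <;> simp [v, h, hb, hw]
  · rcases h : σ i with k | k <;> simp [c, h, k.2]
  · simp only [Function.comp_apply]
    rw [σ.sum_comp (fun k => c k • v k), Fintype.sum_sum_type]
    have : ∑ i : {i // 0 < e i}, e i • w i = ∑ i, e i • w i := by
      rw [← Finset.sum_subtype (Finset.univ.filter fun i => 0 < e i) (by simp) fun i => e i • w i,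
        Finset.sum_filter_of_ne]
      exact fun i _ hi => (he i).lt_of_ne fun h => hi (by simp [← h])
    simp [v, c, this, ← hsum]
  · rw [σ.surjective.range_comp, eq_top_iff, ← b.span_eq]
    exact Submodule.span_mono (by rintro _ ⟨i, rfl⟩; exact ⟨Sum.inl i, rfl⟩)

end ConicHull

/-- A dense convex set in a finite-dimensional space is everything. -/
theorem Convex.eq_univ_of_dense {E : Type*} [NormedAddCommGroup E] [NormedSpace ℝ E]
    [FiniteDimensional ℝ E] {C : Set E} (hC : Convex ℝ C) (hd : Dense C) : C = univ := by
  have hspan : affineSpan ℝ C = ⊤ := by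
    have hcl : IsClosed (affineSpan ℝ C : Set E) := AffineSubspace.closed_of_finiteDimensional _
    rw [← AffineSubspace.coe_eq_univ_iff, ← univ_subset_iff, ← hd.closure_eq]
    exact closure_minimal (subset_affineSpan ℝ C) hcl
  obtain ⟨p, hp⟩ := hC.interior_nonempty_iff_affineSpan_eq_top.2 hspan
  refine eq_univ_of_forall fun x => interior_subset ?_
  have := hC.combo_interior_closure_mem_interior hp (y := (2 : ℝ) • x - p)
    (hd.closure_eq ▸ mem_univ _) (a := 1 / 2) (b := 1 / 2) (by norm_num) (by norm_num) (by norm_num)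
  convert this using 1
  module

theorem exists_injective_forall_mem {ι α : Type*} [Fintype ι] {S : ι → Set α}
    (hS : ∀ i, (S i).Infinite) : ∃ a : ι → α, Function.Injective a ∧ ∀ i, a i ∈ S i := by
  classical
  choose t htS ht using fun i => (hS i).exists_subset_card_eq (Fintype.card ι)
  obtain ⟨a, ha, hat⟩ := (Finset.all_card_le_biUnion_card_iff_exists_injective t).1 fun s => by
    rcases s.eq_empty_or_nonempty with rfl | ⟨i, hi⟩
    · simp
    · calc s.card ≤ (t i).card := by rw [ht]; exact s.card_le_univ
        _ ≤ _ := Finset.card_le_card (Finset.subset_biUnion_of_mem t hi)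
  exact ⟨a, ha, fun i => htS i (hat i)⟩

/-- Integrals over short intervals near prescribed times depend on the lengths of the intervals
approximately linearly. -/
theorem approximatesLinearOn_sum_integral {ι E : Type*} [Fintype ι] [NormedAddCommGroup E]
    [NormedSpace ℝ E] [FiniteDimensional ℝ E] {h : ι → ℝ → E} (hh : ∀ i, Continuous (h i))
    {τ a : ι → ℝ} {ρ : ℝ} {κ : NNReal}
    (hκ : ∀ i s, |s - τ i| < ρ → ‖h i s - h i (τ i)‖ ≤ κ / (Fintype.card ι + 1))
    (ha : ∀ i, |a i - τ i| < ρ / 2) :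
    ApproximatesLinearOn (fun l : ι → ℝ => ∑ i, ∫ s in (a i)..(a i + l i), h i s)
      (Fintype.linearCombination ℝ fun i => h i (τ i)).toContinuousLinearMap
      (Metric.ball 0 (ρ / 2)) κ := by
  have := FiniteDimensional.complete ℝ E
  intro x hx y hy
  have hint : ∀ i p q, IntervalIntegrable (h i) volume p q :=
    fun i p q => (hh i).intervalIntegrable p q
  have hcoord : ∀ z ∈ Metric.ball (0 : ι → ℝ) (ρ / 2), ∀ i, |z i| < ρ / 2 := fun z hz i =>
    (norm_le_pi_norm z i).trans_lt (mem_ball_zero_iff.1 hz)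
  have key : ∀ i, ‖(∫ s in (a i + y i)..(a i + x i), h i s) - (x i - y i) • h i (τ i)‖
      ≤ κ / (Fintype.card ι + 1) * ‖x - y‖ := by
    intro i
    have h1 : (∫ s in (a i + y i)..(a i + x i), h i s) - (x i - y i) • h i (τ i)
        = ∫ s in (a i + y i)..(a i + x i), (h i s - h i (τ i)) := by
      rw [intervalIntegral.integral_sub (hint i _ _) intervalIntegrable_const]
      simp
    rw [h1]
    refine (intervalIntegral.norm_integral_le_of_norm_le_const fun s hs => hκ i s ?_).trans ?_
    · have hxi := abs_lt.1 (hcoord x hx i)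
      have hyi := abs_lt.1 (hcoord y hy i)
      have hai := abs_lt.1 (ha i)
      rw [mem_uIoc] at hs
      rw [abs_lt]
      rcases hs with hs | hs <;> constructor <;> linarith [hs.1, hs.2]
    · gcongr
      simpa using norm_le_pi_norm (x - y) i
  have hexp : (∑ i, ∫ s in (a i)..(a i + x i), h i s) - (∑ i, ∫ s in (a i)..(a i + y i), h i s)
      - (Fintype.linearCombination ℝ fun i => h i (τ i)).toContinuousLinearMap (x - y)
      = ∑ i, ((∫ s in (a i + y i)..(a i + x i), h i s) - (x i - y i) • h i (τ i)) := by
    simp only [LinearMap.coe_toContinuousLinearMap', Fintype.linearCombination_apply,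
      Pi.sub_apply, ← Finset.sum_sub_distrib]
    refine Finset.sum_congr rfl fun i _ => ?_
    rw [intervalIntegral.integral_interval_sub_left (hint i _ _) (hint i _ _)]
  rw [hexp]
  calc _ ≤ ∑ _i : ι, (κ / (Fintype.card ι + 1) * ‖x - y‖ : ℝ) := norm_sum_le_of_le _ fun i _ => key i
    _ = (Fintype.card ι / (Fintype.card ι + 1)) * (κ * ‖x - y‖) := by simp; ring
    _ ≤ 1 * (κ * ‖x - y‖) := by
      gcongr
      rw [div_le_one (by positivity)]
      linarith
    _ = _ := one_mul _

/-- If the values `h i (τ i)` span the space and have a vanishing positive combination, then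
sums of integrals of the `h i` over disjoint intervals fill a neighborhood of the origin. -/
theorem eventually_eq_sum_integral_disjoint {ι E : Type*} [Fintype ι] [NormedAddCommGroup E]
    [NormedSpace ℝ E] [FiniteDimensional ℝ E] {h : ι → ℝ → E} (hh : ∀ i, Continuous (h i))
    {T : ℝ} (hT : 0 < T) {τ : ι → ℝ} (hτ : ∀ i, τ i ∈ Icc 0 T) {c : ι → ℝ} (hc : ∀ i, 0 < c i)
    (hsum : ∑ i, c i • h i (τ i) = 0)
    (hspan : Submodule.span ℝ (range fun i => h i (τ i)) = ⊤) :
    ∀ᶠ z in nhds (0 : E), ∃ a l : ι → ℝ, (∀ i, 0 ≤ a i ∧ 0 ≤ l i ∧ a i + l i ≤ T) ∧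
      Pairwise (Function.onFun Disjoint fun i => Ioc (a i) (a i + l i)) ∧
      z = ∑ i, ∫ s in (a i)..(a i + l i), h i s := by
  have := FiniteDimensional.complete ℝ E
  let L : (ι → ℝ) →L[ℝ] E :=
    (Fintype.linearCombination ℝ fun i => h i (τ i)).toContinuousLinearMap
  have hL : L.range = ⊤ := by
    rw [← hspan, ← Fintype.range_linearCombination]; rfl
  let R := L.nonlinearRightInverseOfSurjective hL
  have hR : (0 : ℝ) < R.nnnorm := L.nonlinearRightInverseOfSurjective_nnnorm_pos hL
  obtain ⟨r, hr, hrc⟩ : ∃ r : ℝ, 0 < r ∧ ∀ i, r ≤ c i := by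
    have : ∀ᶠ r in nhdsWithin (0 : ℝ) (Ioi 0), ∀ i, r ≤ c i :=
      Filter.eventually_all.2 fun i =>
        ((eventually_lt_nhds (hc i)).filter_mono nhdsWithin_le_nhds).mono fun _ => le_of_lt
    exact (eventually_mem_nhdsWithin.and this).exists
  obtain ⟨κ, hκ0, hκ⟩ : ∃ κ : NNReal, 0 < κ ∧ κ * ‖c‖ < ((R.nnnorm : ℝ)⁻¹ - κ) * r := by
    have hpos : 0 < (R.nnnorm : ℝ)⁻¹ * r / (2 * (‖c‖ + r)) := by positivity
    lift (R.nnnorm : ℝ)⁻¹ * r / (2 * (‖c‖ + r)) to NNReal using hpos.le with κ hκ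
    refine ⟨κ, mod_cast hpos, ?_⟩
    have h1 : κ * (‖c‖ + r) = (R.nnnorm : ℝ)⁻¹ * r / 2 := by
      rw [hκ]
      have : ‖c‖ + r ≠ 0 := by positivity
      field_simp
    have h2 : 0 < (R.nnnorm : ℝ)⁻¹ * r := by positivity
    linarith
  obtain ⟨ρ, hρ0, hρ⟩ : ∃ ρ : ℝ, 0 < ρ ∧ ∀ i s, |s - τ i| < ρ →
      ‖h i s - h i (τ i)‖ ≤ κ / (Fintype.card ι + 1) := by
    have : ∀ᶠ ρ in nhdsWithin (0 : ℝ) (Ioi 0), ∀ i s, |s - τ i| < ρ →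
        ‖h i s - h i (τ i)‖ ≤ κ / (Fintype.card ι + 1) := by
      refine Filter.eventually_all.2 fun i => ?_
      obtain ⟨ρ, hρ0, hρ⟩ := Metric.continuous_iff.1 (hh i) (τ i) (κ / (Fintype.card ι + 1))
        (by positivity)
      filter_upwards [(eventually_lt_nhds hρ0).filter_mono nhdsWithin_le_nhds] with ρ' hρ' s hs
      rw [← dist_eq_norm]
      exact (hρ s (hs.trans hρ')).le
    exact (eventually_mem_nhdsWithin.and this).exists
  obtain ⟨a, hainj, ha⟩ := exists_injective_forall_mem
    (S := fun i => Ioo (max 0 (τ i - ρ / 2)) (min T (τ i + ρ / 2))) fun i => Ioo_infinite (by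
      have := hτ i
      simp only [mem_Icc] at this
      simp only [max_lt_iff, lt_min_iff]
      constructor <;> constructor <;> linarith)
  simp only [mem_Ioo, max_lt_iff, lt_min_iff] at ha
  have happrox := approximatesLinearOn_sum_integral hh hρ (a := a) fun i =>
    abs_lt.2 ⟨by linarith [(ha i).1.2], by linarith [(ha i).2.2]⟩
  obtain ⟨ε, hε0, hερ, hεT, hεa⟩ : ∃ ε : ℝ, 0 < ε ∧ ε * (‖c‖ + r) < ρ / 2 ∧
      (∀ i, ε * (‖c‖ + r) < T - a i) ∧
      ∀ i j, a i < a j → ε * (‖c‖ + r) < a j - a i := by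
    have small : ∀ b : ℝ, 0 < b → ∀ᶠ ε in nhdsWithin (0 : ℝ) (Ioi 0), ε * (‖c‖ + r) < b := by
      intro b hb
      have : Continuous fun ε : ℝ => ε * (‖c‖ + r) := by fun_prop
      exact (this.tendsto' 0 0 (by simp)).eventually_lt_const hb |>.filter_mono nhdsWithin_le_nhds
    refine (eventually_mem_nhdsWithin.and ((small _ (by positivity)).and
      ((Filter.eventually_all.2 fun i => small _ ?_).and
      (Filter.eventually_all.2 fun i => Filter.eventually_all.2 fun j => ?_)))).exists
    · linarith [(ha i).2.1]
    · by_cases hij : a i < a j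
      · exact (small _ (sub_pos.2 hij)).mono fun _ h _ => h
      · exact Filter.Eventually.of_forall fun _ h => absurd h hij
  have hnorm : ∀ l ∈ Metric.closedBall (ε • c) (ε * r), ‖l‖ ≤ ε * (‖c‖ + r) := by
    intro l hl
    calc ‖l‖ ≤ ‖ε • c‖ + ‖l - ε • c‖ := norm_le_insert' _ _
      _ ≤ ε * ‖c‖ + ε * r := by
        gcongr
        · rw [norm_smul, Real.norm_of_nonneg hε0.le]
        · exact mem_closedBall_iff_norm.1 hl
      _ = _ := by ring
  have hsub : Metric.closedBall (ε • c) (ε * r) ⊆ Metric.ball 0 (ρ / 2) := fun l hl =>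
    mem_ball_zero_iff.2 ((hnorm l hl).trans_lt hερ)
  have hsurj := happrox.surjOn_closedBall_of_nonlinearRightInverse R (by positivity) hsub
  have hcenter : ‖∑ i, ∫ s in (a i)..(a i + (ε • c) i), h i s‖ ≤ κ * (ε * ‖c‖) := by
    have := happrox (ε • c) (hsub (Metric.mem_closedBall_self (by positivity))) 0
      (Metric.mem_ball_self (by positivity))
    have hLc : (Fintype.linearCombination ℝ fun i => h i (τ i)).toContinuousLinearMap (ε • c) = 0 := by
      rw [map_smul]
      simp [Fintype.linearCombination_apply, hsum]
    rw [sub_zero, hLc, norm_smul, Real.norm_of_nonneg hε0.le] at this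
    simpa using this
  refine Filter.mem_of_superset (Metric.closedBall_mem_nhds_of_mem (x := 0)
    (c := ∑ i, ∫ s in (a i)..(a i + (ε • c) i), h i s)
    (ε := ((R.nnnorm : ℝ)⁻¹ - κ) * (ε * r)) ?_) ?_
  · rw [mem_ball_iff_norm', sub_zero]
    refine hcenter.trans_lt ?_
    nlinarith
  · intro z hz
    obtain ⟨l, hl, rfl⟩ := hsurj hz
    have hl0 : ∀ i, 0 ≤ l i := by
      intro i
      have h1 := (norm_le_pi_norm (l - ε • c) i).trans (mem_closedBall_iff_norm.1 hl)
      simp only [Pi.sub_apply, Pi.smul_apply, smul_eq_mul, Real.norm_eq_abs] at h1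
      have := (abs_le.1 h1).1
      nlinarith [hrc i]
    have hlε : ∀ i, l i ≤ ε * (‖c‖ + r) := fun i =>
      (le_abs_self _).trans ((norm_le_pi_norm l i).trans (hnorm l hl))
    refine ⟨a, l, fun i => ⟨(ha i).1.1.le, hl0 i, by linarith [hlε i, hεT i]⟩, fun i j hij => ?_, rfl⟩
    refine disjoint_left.2 fun s hi hj => ?_
    rcases lt_or_gt_of_ne (hainj.ne hij) with hlt | hlt
    · linarith [hεa i j hlt, hlε i, hi.2, hj.1]
    · linarith [hεa j i hlt, hlε j, hj.2, hi.1]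

/-- The controls `w i`, each switched on during one of finitely many disjoint intervals and
extended by zero, form an admissible control. -/
theorem exists_control_of_disjoint {ι : Type*} [Fintype ι] {m : ℕ} {E : Type*}
    [NormedAddCommGroup E] [NormedSpace ℝ E] {g : Fin m → ℝ → E} (hg : ∀ k, Continuous (g k))
    {U : Set (Fin m → ℝ)} (hU0 : 0 ∈ U) {w : ι → Fin m → ℝ} (hw : ∀ i, w i ∈ U) {T : ℝ}
    {a l : ι → ℝ} (hal : ∀ i, 0 ≤ a i ∧ 0 ≤ l i ∧ a i + l i ≤ T)
    (hdisj : Pairwise (Function.onFun Disjoint fun i => Ioc (a i) (a i + l i))) :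
    ∃ u : ℝ → Fin m → ℝ, Measurable u ∧ (∀ s, u s ∈ U) ∧
      ∫ s in (0:ℝ)..T, ∑ k, u s k • g k s =
        ∑ i, ∫ s in (a i)..(a i + l i), ∑ k, w i k • g k s := by
  classical
  have hcont : ∀ i, Continuous fun s => ∑ k, w i k • g k s := by
    intro i
    fun_prop
  refine ⟨fun s => ∑ i, (Ioc (a i) (a i + l i)).indicator (fun _ => w i) s, ?_, fun s => ?_, ?_⟩
  · exact Finset.measurable_sum _ fun i _ => measurable_const.indicator measurableSet_Ioc
  · by_cases hs : ∃ i, s ∈ Ioc (a i) (a i + l i)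
    · obtain ⟨i, hi⟩ := hs
      beta_reduce
      rw [Finset.sum_eq_single i]
      · simpa [indicator_of_mem hi] using hw i
      · intro j _ hji
        exact indicator_of_notMem (fun hj => disjoint_left.1 (hdisj hji) hj hi) _
      · simp
    · push Not at hs
      beta_reduce
      rwa [Finset.sum_eq_zero fun i _ => indicator_of_notMem (hs i) _]
  · have hpt : ∀ s, ∑ k, (∑ i, (Ioc (a i) (a i + l i)).indicator (fun _ => w i) s) k • g k s =
        ∑ i, (Ioc (a i) (a i + l i)).indicator (fun s => ∑ k, w i k • g k s) s := by
      intro s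
      simp only [Finset.sum_apply, Finset.sum_smul]
      rw [Finset.sum_comm]
      refine Finset.sum_congr rfl fun i _ => ?_
      by_cases hs : s ∈ Ioc (a i) (a i + l i) <;> simp [hs]
    simp only [hpt]
    rw [intervalIntegral.integral_finsetSum]
    · refine Finset.sum_congr rfl fun i _ => ?_
      obtain ⟨h1, h2, h3⟩ := hal i
      rw [intervalIntegral.integral_of_le (by linarith), intervalIntegral.integral_of_le (by linarith),
        setIntegral_indicator measurableSet_Ioc,
        inter_eq_self_of_subset_right (Ioc_subset_Ioc h1 h3)]
    · intro i _
      have := (hcont i).intervalIntegrable (μ := volume) 0 T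
      rw [intervalIntegrable_iff] at this ⊢
      exact this.indicator measurableSet_Ioc

/-- The integral of a function with values in a set lies in the closed conic hull. -/
theorem integral_mem_closure_coneHull {E : Type*} [NormedAddCommGroup E] [NormedSpace ℝ E]
    [CompleteSpace E] {S : Set E} {T : ℝ} (hT : 0 < T) {f : ℝ → E} (hf : ∀ s ∈ Icc 0 T, f s ∈ S) :
    ∫ s in (0:ℝ)..T, f s ∈ closure (coneHull S) := by
  rw [intervalIntegral.integral_of_le hT.le]
  by_cases hi : IntegrableOn f (Ioc 0 T)
  · have havg := (convex_coneHull S).set_average_mem_closure (μ := volume) (t := Ioc 0 T)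
      (by simp [hT]) (by simp)
      ((ae_restrict_mem measurableSet_Ioc).mono fun s hs =>
        subset_coneHull S (hf s (Ioc_subset_Icc_self hs))) hi
    have hsmul := map_mem_closure (continuous_const_smul T) havg
      (t := coneHull S) fun x hx => smul_mem_coneHull hT.le hx
    rw [setAverage_eq] at hsmul
    simpa [hT.le, hT.ne'] using hsmul
  · rw [integral_undef hi]
    exact subset_closure (zero_mem_coneHull S)

/-- A subset of the closed conic hull that is a neighborhood of the origin forces the conic hull
to be everything. -/
theorem coneHull_eq_univ_of_closure_mem_nhds {E : Type*} [NormedAddCommGroup E] [NormedSpace ℝ E]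
    [FiniteDimensional ℝ E] {S : Set E} (h : closure (coneHull S) ∈ nhds 0) :
    coneHull S = univ := by
  refine (convex_coneHull S).eq_univ_of_dense fun x => ?_
  have htend : Filter.Tendsto (fun t : ℝ => t • x) (nhdsWithin 0 (Ioi 0)) (nhds 0) :=
    ((continuous_id.smul continuous_const).tendsto' 0 0 (by simp)).mono_left nhdsWithin_le_nhds
  obtain ⟨t, ht, ht0⟩ := ((htend.eventually h).and self_mem_nhdsWithin).exists
  have ht0 : 0 < t := ht0
  have := map_mem_closure (continuous_const_smul t⁻¹) ht
    (t := coneHull S) fun y hy => smul_mem_coneHull (inv_nonneg.2 ht0.le) hy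
  rwa [inv_smul_smul₀ ht0.ne'] at this

theorem continuous_pushf {d : ℕ} {φ : ℝ → Ed d → Ed d}
    (hφ : ContDiff ℝ (⊤ : ℕ∞) (fun p : ℝ × Ed d => φ p.1 p.2)) {Z : Ed d → Ed d}
    (hZ : Continuous Z) (x : Ed d) : Continuous fun τ => pushf φ Z τ x := by
  have hφx : ContDiff ℝ (⊤ : ℕ∞) fun τ => φ τ x :=
    hφ.comp (contDiff_id.prodMk contDiff_const)
  have hfd : ContDiff ℝ 0 fun τ => fderiv ℝ (φ (-τ)) (φ τ x) := by
    refine ContDiff.fderiv (f := fun τ => φ (-τ)) (m := (⊤ : ℕ∞)) (n := 0) ?_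
      (hφx.of_le (by simp)) (by simp)
    exact hφ.comp (contDiff_fst.neg.prodMk contDiff_snd)
  exact hfd.continuous.clm_apply (hZ.comp hφx.continuous)

theorem injective_fderiv_flow {d : ℕ} {φ : ℝ → Ed d → Ed d}
    (hφ : ContDiff ℝ (⊤ : ℕ∞) (fun p : ℝ × Ed d => φ p.1 p.2)) (hφ0 : ∀ x, φ 0 x = x)
    (hφadd : ∀ s t x, φ (s + t) x = φ s (φ t x)) (t : ℝ) (x : Ed d) :
    Function.Injective (fderiv ℝ (φ t) x) := by
  have hdiff : ∀ s, Differentiable ℝ (φ s) := fun s =>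
    (hφ.comp (contDiff_const.prodMk contDiff_id)).differentiable (by simp)
  have hcomp : φ (-t) ∘ φ t = id := by
    ext1 y
    rw [Function.comp_apply, ← hφadd, neg_add_cancel, hφ0, id]
  have hchain := fderiv_comp x (hdiff (-t) (φ t x)) (hdiff t x)
  rw [hcomp, fderiv_id] at hchain
  refine Function.LeftInverse.injective (g := fderiv ℝ (φ (-t)) (φ t x)) fun v => ?_
  simpa using (DFunLike.congr_fun hchain v).symm

/-- Lemma 3.4, part I: the attainable set of the constrained linear approximation along the
drift solution is a neighborhood of the origin iff `cone Ē = ℝ^d`. -/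
theorem lin_attain_nhds_iff_cone
    {d m : ℕ}
    (X0 : Ed d → Ed d) (X : Fin m → Ed d → Ed d) (U : Set (Fin m → ℝ))
    (hX0 : ContDiff ℝ (⊤ : ℕ∞) X0) (hX : ∀ k, ContDiff ℝ (⊤ : ℕ∞) (X k))
    (hUcomp : IsCompact U) (hU0 : (0 : Fin m → ℝ) ∈ U)
    (φ : ℝ → Ed d → Ed d)
    (hφsmooth : ContDiff ℝ (⊤ : ℕ∞) (fun p : ℝ × Ed d => φ p.1 p.2))
    (hφ0 : ∀ x, φ 0 x = x)
    (hφadd : ∀ s t x, φ (s + t) x = φ s (φ t x))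
    (hφder : ∀ t x, HasDerivAt (fun τ => φ τ x) (X0 (φ t x)) t)
    (tf : ℝ) (htf : 0 < tf) (xbar0 : Ed d) :
    linAttain φ X U tf xbar0 ∈ nhds (0 : Ed d) ↔
      coneHull (EIcc φ X U 0 tf xbar0) = univ := by
  have hg : ∀ k, Continuous fun s => pushf φ (X k) s xbar0 := fun k =>
    continuous_pushf hφsmooth (hX k).continuous xbar0
  have hinj := injective_fderiv_flow hφsmooth hφ0 hφadd tf xbar0
  constructor
  · intro hA
    refine coneHull_eq_univ_of_closure_mem_nhds ?_
    have hpre := (fderiv ℝ (φ tf) xbar0).continuous.continuousAt.preimage_mem_nhds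
      (x := 0) (by rwa [map_zero])
    refine Filter.mem_of_superset hpre ?_
    rintro y ⟨u, -, hu, hy⟩
    rw [hinj hy]
    exact integral_mem_closure_coneHull htf fun s hs => mem_iUnion₂.2 ⟨s, hs, u s, hu s hs, rfl⟩
  · intro hcone
    obtain ⟨n, v, c, hv, hc, hsum, hspan⟩ := exists_pos_combination_eq_zero hcone
    choose τ hτ w hw hvw using fun i => mem_iUnion₂.1 (hv i)
    obtain rfl : v = fun i => ∑ k, w i k • pushf φ (X k) (τ i) xbar0 := funext hvw
    have hev := eventually_eq_sum_integral_disjoint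
      (h := fun i s => ∑ k, w i k • pushf φ (X k) s xbar0) (fun i => by fun_prop)
      htf hτ hc hsum hspan
    have hsurj : Function.Surjective (fderiv ℝ (φ tf) xbar0) :=
      LinearMap.injective_iff_surjective.1 hinj
    have himg := ((fderiv ℝ (φ tf) xbar0).isOpenMap hsurj).image_mem_nhds hev
    rw [map_zero] at himg
    refine Filter.mem_of_superset himg ?_
    rintro _ ⟨_, ⟨a, l, hal, hdisj, rfl⟩, rfl⟩
    obtain ⟨u, hum, huU, hint⟩ := exists_control_of_disjoint hg hU0 hw hal hdisj
    exact ⟨u, hum, fun s _ => huU s, by rw [hint]⟩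
end
end

section
/- (Claim (5.9) in Example 5.3: nonnegative controls generating a closed loop sweep nonnegative area.) Let u : [0,2π] → ℝ be measurable, integrable, with u(s) ≥ 0 for almost every s ∈ [0,2π]. If ∫₀^{2π} u(s) cos s ds = 0 and ∫₀^{2π} u(s) sin s ds = 0, then ∬_{0 ≤ r ≤ s ≤ 2π} u(s) u(r) sin(s − r) dr ds ≥ 0. -/
open Set MeasureTheory Real

lemma intervalIntegrable_mul_sin_sub {u : ℝ → ℝ} {a b : ℝ}
    (hu : IntervalIntegrable u volume a b) (s : ℝ) :
    IntervalIntegrable (fun r => u r * Real.sin (s - r)) volume a b :=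
  hu.mul_continuousOn (by fun_prop)

lemma integral_mul_sin_sub_eq_zero {u : ℝ → ℝ} {a b : ℝ}
    (hu : IntervalIntegrable u volume a b)
    (hcos : ∫ r in a..b, u r * Real.cos r = 0)
    (hsin : ∫ r in a..b, u r * Real.sin r = 0) (s : ℝ) :
    ∫ r in a..b, u r * Real.sin (s - r) = 0 := by
  have hc : IntervalIntegrable (fun r => u r * Real.cos r) volume a b :=
    hu.mul_continuousOn (by fun_prop)
  have hs : IntervalIntegrable (fun r => u r * Real.sin r) volume a b :=
    hu.mul_continuousOn (by fun_prop)
  calc ∫ r in a..b, u r * Real.sin (s - r)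
      = ∫ r in a..b, (Real.sin s * (u r * Real.cos r) - Real.cos s * (u r * Real.sin r)) := by
        congr 1 with r
        rw [Real.sin_sub]
        ring
    _ = 0 := by
        rw [intervalIntegral.integral_sub (hc.const_mul _) (hs.const_mul _),
          intervalIntegral.integral_const_mul, intervalIntegral.integral_const_mul, hcos, hsin]
        simp

/-- For a nonnegative control generating a closed loop, the loop lies on one side of each of its
tangent lines. -/
lemma integral_mul_sin_sub_nonneg {u : ℝ → ℝ}
    (hint : IntegrableOn u (Icc 0 (2 * π)))
    (hpos : ∀ᵐ s ∂(volume.restrict (Icc 0 (2 * π))), 0 ≤ u s)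
    (hcos : ∫ s in (0:ℝ)..(2 * π), u s * Real.cos s = 0)
    (hsin : ∫ s in (0:ℝ)..(2 * π), u s * Real.sin s = 0)
    {s : ℝ} (hs : s ∈ Icc 0 (2 * π)) :
    0 ≤ ∫ r in (0:ℝ)..s, u r * Real.sin (s - r) := by
  obtain ⟨h0, h2⟩ := hs
  have hu : ∀ a b : ℝ, 0 ≤ a → a ≤ b → b ≤ 2 * π → IntervalIntegrable u volume a b :=
    fun a b ha hab hb => (intervalIntegrable_iff_integrableOn_Icc_of_le hab).2
      (hint.mono_set (Icc_subset_Icc ha hb))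
  rcases le_total s π with hsπ | hsπ
  · refine intervalIntegral.integral_nonneg_of_ae_restrict h0 ?_
    filter_upwards [ae_restrict_of_ae_restrict_of_subset (Icc_subset_Icc le_rfl h2) hpos,
      ae_restrict_mem measurableSet_Icc] with r hr hmem
    exact mul_nonneg hr (Real.sin_nonneg_of_nonneg_of_le_pi (by linarith [hmem.2])
      (by linarith [hmem.1]))
  · have hadd := intervalIntegral.integral_add_adjacent_intervals
      (intervalIntegrable_mul_sin_sub (hu 0 s le_rfl h0 h2) s)
      (intervalIntegrable_mul_sin_sub (hu s (2 * π) h0 h2 le_rfl) s)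
    rw [integral_mul_sin_sub_eq_zero (hu 0 (2 * π) le_rfl (h0.trans h2) le_rfl) hcos hsin] at hadd
    have htail : 0 ≤ ∫ r in s..(2 * π), -(u r * Real.sin (s - r)) := by
      refine intervalIntegral.integral_nonneg_of_ae_restrict h2 ?_
      filter_upwards [ae_restrict_of_ae_restrict_of_subset (Icc_subset_Icc h0 le_rfl) hpos,
        ae_restrict_mem measurableSet_Icc] with r hr hmem
      exact neg_nonneg.2 (mul_nonpos_of_nonneg_of_nonpos hr
        (Real.sin_nonpos_of_nonpos_of_neg_pi_le (by linarith [hmem.1]) (by linarith [hmem.2])))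
    rw [intervalIntegral.integral_neg] at htail
    linarith



/-- Claim (5.9): a nonnegative integrable control on `[0,2π]` whose associated planar
curve closes up (`∫ u cos = ∫ u sin = 0`) sweeps a nonnegative area:
`∬_{0 ≤ r ≤ s ≤ 2π} u(s)u(r) sin(s−r) dr ds ≥ 0`. -/
theorem nonneg_area_of_closed_loop
    (u : ℝ → ℝ) (hmeas : Measurable u)
    (hint : IntegrableOn u (Icc 0 (2 * π)))
    (hpos : ∀ᵐ s ∂(volume.restrict (Icc 0 (2 * π))), 0 ≤ u s)
    (hcos : ∫ s in (0:ℝ)..(2 * π), u s * Real.cos s = 0)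
    (hsin : ∫ s in (0:ℝ)..(2 * π), u s * Real.sin s = 0) :
    0 ≤ ∫ p in {q : ℝ × ℝ | 0 ≤ q.1 ∧ q.1 ≤ q.2 ∧ q.2 ≤ 2 * π},
        u p.2 * u p.1 * Real.sin (p.2 - p.1) := by
  have hS : MeasurableSet {q : ℝ × ℝ | 0 ≤ q.1 ∧ q.1 ≤ q.2 ∧ q.2 ≤ 2 * π} :=
    (measurableSet_le measurable_const measurable_fst).inter
      ((measurableSet_le measurable_fst measurable_snd).inter
        (measurableSet_le measurable_snd measurable_const))
  rw [← integral_indicator hS]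
  by_cases hI : Integrable ({q : ℝ × ℝ | 0 ≤ q.1 ∧ q.1 ≤ q.2 ∧ q.2 ≤ 2 * π}.indicator
      fun p => u p.2 * u p.1 * Real.sin (p.2 - p.1)) (volume : Measure (ℝ × ℝ))
  swap
  · exact (integral_undef hI).ge
  rw [Measure.volume_eq_prod] at hI ⊢
  rw [integral_prod_symm _ hI]
  refine integral_nonneg_of_ae ?_
  filter_upwards [(ae_restrict_iff' measurableSet_Icc).1 hpos] with s hus
  by_cases hs : s ∈ Icc 0 (2 * π)
  · have hslice : ∀ r, {q : ℝ × ℝ | 0 ≤ q.1 ∧ q.1 ≤ q.2 ∧ q.2 ≤ 2 * π}.indicator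
        (fun p => u p.2 * u p.1 * Real.sin (p.2 - p.1)) (r, s)
        = (Icc 0 s).indicator (fun r => u s * (u r * Real.sin (s - r))) r := by
      intro r
      simp [indicator_apply, hs.2, mul_assoc]
    simp only [hslice, Pi.zero_apply]
    rw [integral_indicator measurableSet_Icc, integral_const_mul, integral_Icc_eq_integral_Ioc,
      ← intervalIntegral.integral_of_le hs.1]
    exact mul_nonneg (hus hs) (integral_mul_sin_sub_nonneg hint hpos hcos hsin hs)
  · refine (integral_eq_zero_of_ae (Filter.Eventually.of_forall fun r => ?_)).ge
    exact indicator_of_notMem (fun h => hs ⟨h.1.trans h.2.1, h.2.2⟩) _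
end
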